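/- The set of subfields F of the algebraic closure of ℚ such that the subset ℤ of F is definable by a first-order formula in the language of rings with parameters from F, or the ring of integers 𝒪_F (the integral closure of ℤ in F) is definable by a first-order formula in the language of rings with parameters from F, is a meager subset of the space 𝓔 of all subfields of the algebraic closure of ℚ. -/

import Mathlib

open FirstOrder Topology

noncomputable section

/-- `Q̄`, the algebraic closure of `ℚ`. -/
abbrev Qbar : Type := AlgebraicClosure ℚ

/-- `Prop` with the discrete two-point topology. -/
def propDiscrete : TopologicalSpace Prop := ⊥

/-- The product topology on the powerset `2^Q̄`, identified with `Set Q̄ = Q̄ → Prop`,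
where each factor `Prop` carries the discrete two-point topology. -/
def powersetTopology : TopologicalSpace (Set Qbar) :=
  @Pi.topologicalSpace Qbar (fun _ => Prop) (fun _ => propDiscrete)

/-- The space `𝓔` of all subfields of `Q̄`, with the subspace topology induced from `2^Q̄`
via the identification of a subfield with its underlying set of elements. -/
instance subfieldTopology : TopologicalSpace (Subfield Qbar) :=
  powersetTopology.induced (fun F => (F : Set Qbar))

/-- A subset `s` of a field `F` is definable (with parameters) if it is the solution set in `F`
of a first-order formula in the language of rings with parameters from `F`. -/
def DefinableIn (F : Type*) [Field F] (s : Set F) : Prop :=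
  letI := FirstOrder.Ring.compatibleRingOfRing F
  Set.Definable₁ (Set.univ : Set F) FirstOrder.Language.ring s

/-- The subset `ℤ` of a field `F`. -/
def intSet (F : Type*) [Field F] : Set F := Set.range (Int.cast : ℤ → F)

/-- The ring of integers `𝒪_F` of `F`: the integral closure of `ℤ` in `F`. -/
def ringOfIntegers (F : Type*) [Field F] : Set F := {x : F | IsIntegral ℤ x}

section Preliminaries

open Polynomial

/-- If `y ^ n` is divisible by a prime number `p` in the ring of algebraic integers, then so is the
trace of `y`. -/
theorem prime_dvd_trace_of_pow_eq {N : Type*} [Field N] [NumberField N] {p : ℕ} (hp : p.Prime)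
    {y z : N} (hy : IsIntegral ℤ y) (hz : IsIntegral ℤ z) {n : ℕ} (h : y ^ n = p * z) :
    ∃ t : ℤ, Algebra.trace ℚ N y = (p * t : ℤ) := by
  obtain ⟨t, ht⟩ := IsIntegrallyClosed.isIntegral_iff.1 (Algebra.isIntegral_trace (R := ℤ) (L := ℚ) hy)
  let O := integralClosure ℤ ℂ
  let I : Ideal O := Ideal.span {(p : O)}
  have key : ∀ σ : N →ₐ[ℚ] ℂ, ∃ w : O, (w : ℂ) = σ y ∧ w ∈ I.radical := by
    intro σ
    refine ⟨⟨σ y, hy.map σ⟩, rfl, n, ?_⟩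
    rw [Ideal.mem_span_singleton]
    refine ⟨⟨σ z, hz.map σ⟩, ?_⟩
    apply Subtype.ext
    simpa using! congrArg σ h
  choose w hw hwI using key
  have hsum : (t : O) = ∑ σ, w σ := by
    apply Subtype.ext
    have := trace_eq_sum_embeddings (K := ℚ) (L := N) ℂ (x := y)
    rw [← ht] at this
    simp only [AddSubmonoidClass.coe_finsetSum, hw]
    rw [← this]
    simp
  have hrad : (t : O) ∈ I.radical := hsum ▸ Ideal.sum_mem _ fun σ _ => hwI σ
  obtain ⟨k, hk⟩ := hrad
  rw [Ideal.mem_span_singleton] at hk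
  obtain ⟨v, hv⟩ := hk
  have hv' : ((t ^ k : ℤ) : ℂ) = p * (v : ℂ) := by
    have := congrArg (Subtype.val) hv
    simpa using! this
  have hq : IsIntegral ℤ (((t ^ k : ℤ) : ℚ) / p) := by
    have h1 : IsIntegral ℤ (algebraMap ℚ ℂ (((t ^ k : ℤ) : ℚ) / p)) := by
      have : algebraMap ℚ ℂ (((t ^ k : ℤ) : ℚ) / p) = v := by
        have hp0 : (p : ℂ) ≠ 0 := by exact_mod_cast hp.ne_zero
        simp only [map_div₀, map_intCast, map_natCast]
        rw [hv']; field_simp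
      rw [this]; exact v.2
    exact (isIntegral_algebraMap_iff (algebraMap ℚ ℂ).injective).1 h1
  obtain ⟨s, hs⟩ := IsIntegrallyClosed.isIntegral_iff.1 hq
  have hdvd : (p : ℤ) ∣ t ^ k := by
    refine ⟨s, ?_⟩
    have hp0 : (p : ℚ) ≠ 0 := by exact_mod_cast hp.ne_zero
    have : ((t ^ k : ℤ) : ℚ) = ((p * s : ℤ) : ℚ) := by
      push_cast at hs ⊢
      have hs' : (s : ℚ) = t ^ k / p := by simpa using hs
      rw [hs']; field_simp
    exact_mod_cast this
  obtain ⟨t', rfl⟩ := (Nat.prime_iff_prime_int.1 hp).dvd_of_dvd_pow hdvd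
  exact ⟨t', by simpa using ht.symm⟩

theorem trace_pow_gen_mul_coord {K N : Type*} [Field K] [Field N] [Algebra K N]
    (pb : PowerBasis K N) {m : K} (hm : pb.gen ^ pb.dim = algebraMap K N m)
    (β : N) (i : Fin pb.dim) (hi : 0 < (i : ℕ)) :
    Algebra.trace K N (β * pb.gen ^ (pb.dim - i)) = pb.dim * m * pb.basis.repr β i := by
  have htr : ∀ j : ℕ, ¬ pb.dim ∣ j → Algebra.trace K N (pb.gen ^ j) = 0 := by
    intro j hj
    rw [Algebra.trace_eq_matrix_trace pb.basis, Matrix.trace]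
    refine Finset.sum_eq_zero fun k _ => ?_
    rw [Matrix.diag_apply, Algebra.leftMulMatrix_eq_repr_mul, pb.basis_eq_pow, ← pow_add]
    have hpos : 0 < pb.dim := k.pos
    have : pb.gen ^ (j + (k : ℕ)) =
        (m ^ ((j + k) / pb.dim)) • pb.basis ⟨(j + k) % pb.dim, Nat.mod_lt _ hpos⟩ := by
      rw [pb.basis_eq_pow, Algebra.smul_def, map_pow, ← hm, ← pow_mul, ← pow_add, Nat.div_add_mod]
    rw [this, map_smul, Finsupp.smul_apply, Module.Basis.repr_self, Finsupp.single_apply, if_neg,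
      smul_zero]
    intro h
    have h' : (j + (k : ℕ)) % pb.dim = k := congrArg Fin.val h
    apply hj
    have h2 : (j + (k : ℕ)) ≡ 0 + k [MOD pb.dim] := by
      rw [Nat.ModEq, h', zero_add, Nat.mod_eq_of_lt k.2]
    exact (Nat.modEq_zero_iff_dvd).1 (Nat.ModEq.add_right_cancel' _ h2)
  have hfin : pb.dim = Module.finrank K N := pb.finrank.symm
  conv_lhs => rw [← pb.basis.sum_repr β]
  rw [Finset.sum_mul, map_sum, Finset.sum_eq_single i]
  · rw [smul_mul_assoc, map_smul, pb.basis_eq_pow, ← pow_add,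
      Nat.add_sub_cancel' i.2.le, hm, Algebra.trace_algebraMap, ← hfin]
    simp; ring
  · intro j _ hj
    rw [smul_mul_assoc, map_smul, pb.basis_eq_pow, ← pow_add, htr, smul_zero]
    rintro ⟨c, hc⟩
    have h1 := j.2
    have h2 := i.2
    have hne : (j : ℕ) ≠ i := fun h => hj (Fin.ext h)
    rcases c with _ | _ | c
    · omega
    · omega
    · have : pb.dim * 2 ≤ pb.dim * (c + 1 + 1) := Nat.mul_le_mul_left _ (by omega)
      omega
  · simp

/-- An integral element of `K(p ^ (1 / n))` whose conjugates grow at most like the `ρ`-th power of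
the conjugates of `p ^ (1 / n)` is a polynomial of degree at most `ρ` in `p ^ (1 / n)`,
provided that the prime `p` is large. -/
theorem exists_polynomial_of_norm_embedding_le (K : Type*) [Field K] [NumberField K]
    (n ρ : ℕ) (C : ℝ) : ∃ p₀ : ℕ, ∀ p : ℕ, p.Prime → p₀ ≤ p →
      ∀ (N : Type*) [Field N] [NumberField N] [Algebra K N] (pb : PowerBasis K N),
      pb.dim = n → pb.gen ^ n = p → ∀ β : N, IsIntegral ℤ β →
      (∀ σ : N →ₐ[ℚ] ℂ, ‖σ β‖ ≤ C * ‖σ pb.gen‖ ^ ρ) →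
      ∃ P : K[X], P.natDegree ≤ ρ ∧ aeval pb.gen P = β := by
  classical
  let b := NumberField.integralBasis K
  obtain ⟨T, hT0, hT⟩ : ∃ T : ℝ, 0 ≤ T ∧ ∀ i, ∀ τ : K →+* ℂ, ‖τ (b i)‖ ≤ T := by
    refine ⟨∑ i, ∑ τ : K →+* ℂ, ‖τ (b i)‖, by positivity, fun i τ => ?_⟩
    refine le_trans ?_ (Finset.single_le_sum (f := fun i => ∑ τ : K →+* ℂ, ‖τ (b i)‖)
      (fun j _ => by positivity) (Finset.mem_univ i))
    exact Finset.single_le_sum (f := fun τ : K →+* ℂ => ‖τ (b i)‖)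
      (fun j _ => by positivity) (Finset.mem_univ τ)
  let Q : ℝ := (Module.finrank ℚ K * n : ℕ) * (|C| * T)
  obtain ⟨p₀, hp₀⟩ := exists_nat_gt (Q ^ n)
  refine ⟨p₀, fun p hp hpp N _ _ _ pb hdim hgen β hβ hσ => ?_⟩
  have hnpos : 0 < n := hdim ▸ pb.dim_pos
  have hpQ : Q ^ n < p := hp₀.trans_le (by exact_mod_cast hpp)
  have hgenint : IsIntegral ℤ pb.gen := by
    refine IsIntegral.of_pow hnpos ?_
    rw [hgen]; exact isIntegral_algebraMap (R := ℤ) (x := (p : ℤ)) |> fun h => by simpa using h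
  have hm : pb.gen ^ pb.dim = algebraMap K N (p : K) := by rw [hdim, hgen]; simp
  have hnorm : ∀ σ : N →ₐ[ℚ] ℂ, ‖σ pb.gen‖ ^ n = p := by
    intro σ
    rw [← norm_pow, ← map_pow, hgen]; simp
  have hone : ∀ σ : N →ₐ[ℚ] ℂ, 1 ≤ ‖σ pb.gen‖ := by
    intro σ
    by_contra! h
    have h1 := pow_le_one₀ (n := n) (norm_nonneg (σ pb.gen)) h.le
    rw [hnorm] at h1
    have : (1 : ℝ) < p := by exact_mod_cast hp.one_lt
    linarith
  have hcoord : ∀ i : Fin pb.dim, ρ < i → pb.basis.repr β i = 0 := by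
    intro i hi
    have htr0 : ∀ k, Algebra.trace ℚ K (pb.basis.repr β i * b k) = 0 := by
      intro k
      have hbk : IsIntegral ℤ (b k) := by
        rw [NumberField.integralBasis_apply]
        exact NumberField.RingOfIntegers.isIntegral_coe _
      have hbk' : IsIntegral ℤ (algebraMap K N (b k)) := hbk.map (IsScalarTower.toAlgHom ℤ K N)
      set y := β * pb.gen ^ (pb.dim - i) * algebraMap K N (b k) with hy
      have hyint : IsIntegral ℤ y := (hβ.mul (hgenint.pow _)).mul hbk'
      have hpow : y ^ n = p * ((β * algebraMap K N (b k)) ^ n * pb.gen ^ (n * (pb.dim - i - 1))) := by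
        obtain ⟨e, he⟩ : ∃ e, pb.dim - i = e + 1 := ⟨pb.dim - i - 1, by have := i.2; omega⟩
        rw [hy, ← hgen, he]; simp only [Nat.add_sub_cancel]; ring
      obtain ⟨t, ht⟩ := prime_dvd_trace_of_pow_eq hp hyint
        (((hβ.mul hbk').pow n).mul (hgenint.pow _)) hpow
      have h1 : Algebra.trace ℚ N y = n * p * Algebra.trace ℚ K (pb.basis.repr β i * b k) := by
        rw [← Algebra.trace_trace (S := K), hy, mul_comm _ (algebraMap K N (b k)),
          ← Algebra.smul_def, map_smul, trace_pow_gen_mul_coord pb hm β i (by omega),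
          smul_eq_mul]
        have hdimK : (pb.dim : K) = n := by rw [hdim]
        have : b k * (pb.dim * p * pb.basis.repr β i) =
          ((n * p : ℚ)) • (pb.basis.repr β i * b k) := by
          rw [Algebra.smul_def, hdimK]; simp; ring
        rw [this, map_smul, smul_eq_mul]
      have h2 : ‖algebraMap ℚ ℂ (Algebra.trace ℚ N y)‖ < p := by
        rw [trace_eq_sum_embeddings (K := ℚ) (L := N) ℂ]
        obtain ⟨σ₀⟩ : Nonempty (N →ₐ[ℚ] ℂ) := ⟨IsAlgClosed.lift⟩
        let R : ℝ := ‖σ₀ pb.gen‖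
        have hR : ∀ σ : N →ₐ[ℚ] ℂ, ‖σ pb.gen‖ = R := fun σ =>
          (pow_left_inj₀ (norm_nonneg _) (norm_nonneg _) hnpos.ne').1
            ((hnorm σ).trans (hnorm σ₀).symm)
        have hR0 : 0 ≤ R := norm_nonneg _
        have hQR : Q < R := by
          refine lt_of_pow_lt_pow_left₀ n hR0 ?_
          rw [hnorm σ₀]; exact hpQ
        have hterm : ∀ σ : N →ₐ[ℚ] ℂ, ‖σ y‖ ≤ (|C| * T) * R ^ (n - 1) := by
          intro σ
          rw [hy, map_mul, map_mul, norm_mul, norm_mul, map_pow, norm_pow, hR]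
          have e1 : ‖σ β‖ ≤ |C| * R ^ ρ := (hσ σ).trans (by
            rw [hR]; gcongr; exact le_abs_self C)
          have e2 : ‖σ (algebraMap K N (b k))‖ ≤ T := hT k ((σ : N →+* ℂ).comp (algebraMap K N))
          calc _ ≤ |C| * R ^ ρ * R ^ (pb.dim - i) * T := by gcongr
            _ = |C| * T * R ^ (ρ + (pb.dim - i)) := by ring
            _ ≤ _ := by
              gcongr
              · exact hone σ₀
              · have := i.2; omega
        have hcard : Fintype.card (N →ₐ[ℚ] ℂ) = Module.finrank ℚ K * n := by
          rw [AlgHom.card, ← Module.finrank_mul_finrank ℚ K N, pb.finrank, hdim]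
        calc ‖∑ σ : N →ₐ[ℚ] ℂ, σ y‖ ≤ ∑ σ : N →ₐ[ℚ] ℂ, (|C| * T) * R ^ (n - 1) :=
              norm_sum_le_of_le _ fun σ _ => hterm σ
          _ = Q * R ^ (n - 1) := by
            rw [Finset.sum_const, Finset.card_univ, hcard, nsmul_eq_mul]; ring
          _ < R * R ^ (n - 1) := by
            have : 0 < R := zero_lt_one.trans_le (hone σ₀)
            gcongr
          _ = p := by rw [← hnorm σ₀, ← pow_succ', Nat.sub_add_cancel hnpos]
      rw [ht] at h2
      have h3 : t = 0 := by
        by_contra h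
        have : (1 : ℝ) ≤ |(t : ℝ)| := by exact_mod_cast Int.one_le_abs h
        have hpp : (0 : ℝ) < p := by exact_mod_cast hp.pos
        simp at h2
        nlinarith
      rw [h1, h3] at ht
      have hn0 : (n : ℚ) ≠ 0 := by exact_mod_cast hnpos.ne'
      have hp0 : (p : ℚ) ≠ 0 := by exact_mod_cast hp.ne_zero
      simpa [hn0, hp0] using ht
    have hnd := traceForm_nondegenerate ℚ K
    refine hnd.1 _ fun v => ?_
    rw [Algebra.traceForm_apply]
    rw [← b.sum_repr v, Finset.mul_sum, map_sum]
    refine Finset.sum_eq_zero fun k _ => ?_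
    rw [mul_smul_comm, map_smul, htr0, smul_zero]
  refine ⟨∑ i : Fin pb.dim, if ρ < i then 0 else monomial (i : ℕ) (pb.basis.repr β i), ?_, ?_⟩
  · refine natDegree_sum_le_of_forall_le _ _ fun i _ => ?_
    split_ifs with h
    · simp
    · exact (natDegree_monomial_le _).trans (not_lt.1 h)
  · conv_rhs => rw [← pb.basis.sum_repr β]
    rw [map_sum]
    refine Finset.sum_congr rfl fun i _ => ?_
    split_ifs with h
    · rw [hcoord i h]; simp
    · rw [aeval_monomial, pb.basis_eq_pow, Algebra.smul_def]

theorem exists_pos_nat_mul_isIntegral {K : Type*} [Field K] [NumberField K] (S : Finset K) :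
    ∃ m : ℕ, 0 < m ∧ ∀ c ∈ S, IsIntegral ℤ ((m : K) * c) := by
  classical
  induction S using Finset.induction with
  | empty => exact ⟨1, one_pos, by simp⟩
  | insert c S _ ih =>
    obtain ⟨m, hm, h⟩ := ih
    have hc : IsAlgebraic ℤ c := (IsFractionRing.isAlgebraic_iff ℤ ℚ K).2 (Algebra.IsAlgebraic.isAlgebraic c)
    obtain ⟨a, ha, hac⟩ := hc.exists_integral_multiple
    have habs : IsIntegral ℤ ((a.natAbs : K) * c) := by
      rcases Int.natAbs_eq a with h | h
      · rw [h] at hac; simpa [Algebra.smul_def] using hac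
      · rw [h] at hac; simpa [Algebra.smul_def] using hac.neg
    have hnat : ∀ k : ℕ, IsIntegral ℤ (k : K) := fun k => by
      simpa using isIntegral_algebraMap (R := ℤ) (A := K) (x := (k : ℤ))
    refine ⟨m * a.natAbs, Nat.mul_pos hm (Int.natAbs_pos.2 ha), fun x hx => ?_⟩
    push_cast
    rcases Finset.mem_insert.1 hx with rfl | hx
    · rw [mul_assoc]; exact (hnat m).mul habs
    · rw [mul_right_comm, mul_comm]; exact (hnat _).mul (h x hx)

theorem exists_bounds_coeff_map_aeval {K : Type*} [Field K] [NumberField K] (r : K[X][X]) :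
    ∃ (m D : ℕ) (C : ℝ), 0 < m ∧ 0 ≤ C ∧ (∀ j, (r.coeff j).natDegree ≤ D) ∧
      ∀ (N : Type*) [Field N] [NumberField N] [Algebra K N] (u : N), IsIntegral ℤ u →
      ∀ j, IsIntegral ℤ ((m : N) * aeval (u / 2) (r.coeff j)) ∧
        ∀ σ : N →ₐ[ℚ] ℂ, 1 ≤ ‖σ u‖ → ‖σ (aeval (u / 2) (r.coeff j))‖ ≤ C * ‖σ u‖ ^ D := by
  classical
  let D := r.support.sup fun j => (r.coeff j).natDegree
  have hD : ∀ j, (r.coeff j).natDegree ≤ D := fun j => by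
    by_cases hj : j ∈ r.support
    · exact Finset.le_sup (f := fun j => (r.coeff j).natDegree) hj
    · rw [notMem_support_iff.1 hj]; simp
  let S : Finset K := (r.support ×ˢ Finset.range (D + 1)).image fun x => (r.coeff x.1).coeff x.2
  obtain ⟨m, hm, hS⟩ := exists_pos_nat_mul_isIntegral S
  have hS' : ∀ j, ∀ k ∈ Finset.range (D + 1), IsIntegral ℤ ((m : K) * (r.coeff j).coeff k) := by
    intro j k hk
    by_cases hj : j ∈ r.support
    · exact hS _ (Finset.mem_image.2 ⟨(j, k), Finset.mem_product.2 ⟨hj, hk⟩, rfl⟩)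
    · rw [notMem_support_iff.1 hj]; simp [isIntegral_zero]
  let C : ℝ := ∑ j ∈ r.support, ∑ k ∈ Finset.range (D + 1), ∑ τ : K →+* ℂ,
    ‖τ ((r.coeff j).coeff k)‖
  have hexp : ∀ {N : Type _} [Field N] [Algebra K N] (u : N) (j : ℕ), aeval u (r.coeff j) =
      ∑ k ∈ Finset.range (D + 1), algebraMap K N ((r.coeff j).coeff k) * u ^ k := by
    intro N _ _ u j
    rw [aeval_eq_sum_range' (Nat.lt_succ_of_le (hD j))]
    simp [Algebra.smul_def]
  refine ⟨m * 2 ^ D, D, C, by positivity, by positivity, hD, fun N _ _ _ u hu j => ⟨?_, ?_⟩⟩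
  · rw [hexp, Finset.mul_sum]
    refine IsIntegral.sum _ fun k hk => ?_
    have hkD : k ≤ D := Nat.lt_succ_iff.1 (Finset.mem_range.1 hk)
    have e : ((m * 2 ^ D : ℕ) : N) * (algebraMap K N ((r.coeff j).coeff k) * (u / 2) ^ k) =
        algebraMap K N ((m : K) * (r.coeff j).coeff k) * ((2 ^ (D - k) : ℕ) : N) * u ^ k := by
      have : (2 : N) ^ D = 2 ^ (D - k) * 2 ^ k := by rw [← pow_add, Nat.sub_add_cancel hkD]
      push_cast
      rw [this, div_pow]
      field_simp
    rw [e]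
    have hnat : ∀ k : ℕ, IsIntegral ℤ (k : N) := fun k => by
      simpa using isIntegral_algebraMap (R := ℤ) (A := N) (x := (k : ℤ))
    exact (((hS' j k hk).map (IsScalarTower.toAlgHom ℤ K N)).mul (hnat _)).mul (hu.pow _)
  · intro σ hσ
    by_cases hj : j ∈ r.support
    · rw [hexp, map_sum]
      refine (norm_sum_le _ _).trans ?_
      have hterm : ∀ k ∈ Finset.range (D + 1),
          ‖σ (algebraMap K N ((r.coeff j).coeff k) * (u / 2) ^ k)‖ ≤
          (∑ τ : K →+* ℂ, ‖τ ((r.coeff j).coeff k)‖) * ‖σ u‖ ^ D := by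
        intro k hk
        have hkD : k ≤ D := Nat.lt_succ_iff.1 (Finset.mem_range.1 hk)
        rw [map_mul, norm_mul, map_pow, norm_pow, map_div₀, norm_div, map_ofNat]
        have h1 : ‖σ (algebraMap K N ((r.coeff j).coeff k))‖ ≤
            ∑ τ : K →+* ℂ, ‖τ ((r.coeff j).coeff k)‖ :=
          Finset.single_le_sum (f := fun τ : K →+* ℂ => ‖τ ((r.coeff j).coeff k)‖)
            (fun _ _ => norm_nonneg _) (Finset.mem_univ ((σ : N →+* ℂ).comp (algebraMap K N)))
        have h2 : (‖σ u‖ / ‖(2 : ℂ)‖) ^ k ≤ ‖σ u‖ ^ D := by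
          calc _ ≤ ‖σ u‖ ^ k := by
                gcongr
                exact div_le_self (norm_nonneg _) (by simp)
            _ ≤ _ := pow_le_pow_right₀ hσ hkD
        gcongr
      refine (Finset.sum_le_sum hterm).trans ?_
      rw [← Finset.sum_mul]
      gcongr
      exact Finset.single_le_sum (f := fun j => ∑ k ∈ Finset.range (D + 1), ∑ τ : K →+* ℂ,
        ‖τ ((r.coeff j).coeff k)‖) (fun _ _ => by positivity) hj
    · rw [notMem_support_iff.1 hj]; simp only [map_zero, norm_zero]; positivity

/-- An explicit instance of Hilbert's irreducibility theorem: an irreducible polynomial over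
`K[X]` stays irreducible when `X` is specialized to half of an `n`-th root of a prime `p`,
for all large `n` and all `p` large with respect to `n`. -/
theorem exists_irreducible_map_aeval (K : Type*) [Field K] [NumberField K] (r : K[X][X])
    (hr : r.Monic) (hirr : Irreducible r) :
    ∃ n₀ : ℕ, ∀ n, n₀ ≤ n → ∃ p₀ : ℕ, ∀ p : ℕ, p.Prime → p₀ ≤ p →
      ∀ (N : Type*) [Field N] [NumberField N] [Algebra K N] (pb : PowerBasis K N),
      pb.dim = n → pb.gen ^ n = p →
      Irreducible (r.map (aeval (pb.gen / 2) : K[X] →ₐ[K] N).toRingHom) := by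
  obtain ⟨m, D, B, hm, hC, hD, hbd⟩ := exists_bounds_coeff_map_aeval r
  set d := r.natDegree with hd
  let B' : ℝ := m ^ d * ((B + 1) ^ d * d.choose (d / 2))
  refine ⟨2 * (D * d) + D + 1, fun n hn => ?_⟩
  obtain ⟨p₀, hp₀⟩ := exists_polynomial_of_norm_embedding_le K n (D * d) B'
  refine ⟨p₀, fun p hp hpp N _ _ _ pb hdim hgen => ?_⟩
  set φ : K[X] →+* N := (aeval (pb.gen / 2) : K[X] →ₐ[K] N).toRingHom with hφ
  set f := r.map φ with hf
  have hfm : f.Monic := hr.map φ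
  have hnpos : 0 < n := hdim ▸ pb.dim_pos
  have hgenint : IsIntegral ℤ pb.gen := by
    refine IsIntegral.of_pow hnpos ?_
    rw [hgen]; simpa using isIntegral_algebraMap (R := ℤ) (A := N) (x := (p : ℤ))
  have hone : ∀ σ : N →ₐ[ℚ] ℂ, 1 ≤ ‖σ pb.gen‖ := by
    intro σ
    by_contra! h
    have h1 := pow_le_one₀ (n := n) (norm_nonneg (σ pb.gen)) h.le
    rw [← norm_pow, ← map_pow, hgen] at h1
    have : (1 : ℝ) < p := by exact_mod_cast hp.one_lt
    simp at h1
    linarith [show (p : ℝ) ≤ 1 by exact_mod_cast h1]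
  have hmN : (m : N) ≠ 0 := by exact_mod_cast Nat.pos_iff_ne_zero.1 hm
  -- coefficients of monic divisors are polynomials in `pb.gen / 2` of small degree
  have key : ∀ q : N[X], q.Monic → q ∣ f → ∃ Q : K[X][X], Q.Monic ∧ Q.natDegree = q.natDegree ∧
      (∀ j, (Q.coeff j).natDegree ≤ D * d) ∧ Q.map φ = q := by
    intro q hq hqf
    have hqd : q.natDegree ≤ d := by
      have := natDegree_le_of_dvd hqf hfm.ne_zero
      rwa [hf, hr.natDegree_map] at this
    have hint : ∀ j, IsIntegral ℤ ((m : N) ^ (q.natDegree - j) * q.coeff j) := by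
      intro j
      have hdvd : q.scaleRoots (m : N) ∣ f.scaleRoots (m : N) := scaleRoots_dvd _ _ hqf
      have hlift : f.scaleRoots (m : N) ∈ lifts (algebraMap (integralClosure ℤ N) N) := by
        rw [lifts_iff_coeff_lifts]
        intro k
        rw [Subalgebra.setRange_algebraMap]
        change IsIntegral ℤ _
        rw [coeff_scaleRoots]
        rcases lt_or_ge k f.natDegree with hk | hk
        · obtain ⟨e, he⟩ : ∃ e, f.natDegree - k = e + 1 := ⟨f.natDegree - k - 1, by omega⟩
          rw [he, pow_succ', ← mul_assoc, mul_comm (f.coeff k), hf, coeff_map]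
          refine IsIntegral.mul (hbd N pb.gen hgenint k).1 (IsIntegral.pow ?_ _)
          simpa using isIntegral_algebraMap (R := ℤ) (A := N) (x := (m : ℤ))
        · rw [Nat.sub_eq_zero_of_le hk, pow_zero, mul_one]
          rcases hk.eq_or_lt with hk | hk
          · rw [← hk, hfm.coeff_natDegree]; exact isIntegral_one
          · rw [coeff_eq_zero_of_natDegree_lt hk]; exact isIntegral_zero
      obtain ⟨g, hg, -, hgm⟩ := lifts_and_natDegree_eq_and_monic hlift
        ((monic_scaleRoots_iff _).2 hfm)
      have h1 := isIntegral_coeff_of_dvd (S := N) g (q.scaleRoots (m : N)) hgm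
        ((monic_scaleRoots_iff _).2 hq) (by rw [hg]; exact hdvd) j
      have h2 : IsIntegral ℤ ((q.scaleRoots (m : N)).coeff j) :=
        isIntegral_trans (R := ℤ) (A := integralClosure ℤ N) _ h1
      rwa [coeff_scaleRoots, mul_comm] at h2
    have hnorm : ∀ j, ∀ σ : N →ₐ[ℚ] ℂ, ‖σ ((m : N) ^ (q.natDegree - j) * q.coeff j)‖ ≤
        B' * ‖σ pb.gen‖ ^ (D * d) := by
      intro j σ
      set R := ‖σ pb.gen‖ with hR
      have hR1 : 1 ≤ R := hone σ
      have hRD : 1 ≤ R ^ D := one_le_pow₀ hR1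
      have hroots : ∀ z ∈ (q.map (σ : N →+* ℂ)).roots, ‖z‖ ≤ B * R ^ D + 1 := by
        intro z hz
        have hz' : IsRoot (f.map (σ : N →+* ℂ)) z :=
          (isRoot_of_mem_roots hz).dvd (map_dvd (mapRingHom (σ : N →+* ℂ)) hqf)
        have hb := hz'.norm_lt_cauchyBound (hfm.map _).ne_zero
        have hb' : ‖z‖ < (cauchyBound (f.map (σ : N →+* ℂ)) : ℝ) := by exact_mod_cast hb
        refine hb'.le.trans ?_
        rw [cauchyBound, (hfm.map _).leadingCoeff]
        simp only [nnnorm_one, div_one, NNReal.coe_add, NNReal.coe_one]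
        gcongr
        have : ∀ k ∈ Finset.range (f.map (σ : N →+* ℂ)).natDegree,
            ‖(f.map (σ : N →+* ℂ)).coeff k‖₊ ≤ Real.toNNReal (B * R ^ D) := by
          intro k _
          rw [← NNReal.coe_le_coe, Real.coe_toNNReal _ (by positivity), coe_nnnorm, coeff_map, hf,
            coeff_map]
          exact (hbd N pb.gen hgenint k).2 σ hR1
        have h2 := Finset.sup_le this
        rw [← NNReal.coe_le_coe, Real.coe_toNNReal _ (by positivity)] at h2
        exact h2
      have h1 := coeff_bdd_of_roots_le (σ : N →+* ℂ) hq (IsAlgClosed.splits _) hqd hroots j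
      rw [coeff_map, max_eq_left (by nlinarith [mul_nonneg hC (zero_le_one.trans hRD)])] at h1
      rw [map_mul, norm_mul, map_pow, norm_pow, map_natCast, Complex.norm_natCast]
      have hm1 : (1 : ℝ) ≤ m := by exact_mod_cast hm
      have h2 : B * R ^ D + 1 ≤ (B + 1) * R ^ D := by nlinarith
      calc (m : ℝ) ^ (q.natDegree - j) * ‖σ (q.coeff j)‖
          ≤ m ^ d * (((B + 1) * R ^ D) ^ d * d.choose (d / 2)) := by
            gcongr
            · omega
            · refine h1.trans ?_
              gcongr
        _ = B' * R ^ (D * d) := by rw [mul_pow, ← pow_mul]; ring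
    choose P hPd hP using fun j => hp₀ p hp hpp N pb hdim hgen _ (hint j) (hnorm j)
    let P' : ℕ → K[X] := fun j => C ((m : K) ^ (q.natDegree - j))⁻¹ * (P j).comp (C 2 * X)
    have hP' : ∀ j, φ (P' j) = q.coeff j := by
      intro j
      have h2 : (2 : N) * (pb.gen / 2) = pb.gen := by field_simp
      change aeval (pb.gen / 2) (P' j) = _
      simp only [P', map_mul, aeval_C, aeval_comp, aeval_X, map_ofNat, h2, hP, map_inv₀, map_pow,
        map_natCast]
      rw [inv_mul_cancel_left₀ (pow_ne_zero _ hmN)]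
    let Q : K[X][X] := X ^ q.natDegree + ∑ j ∈ Finset.range q.natDegree, C (P' j) * X ^ j
    have hlt : (∑ j ∈ Finset.range q.natDegree, C (P' j) * X ^ j).degree <
        (q.natDegree : WithBot ℕ) := by
      rcases Nat.eq_zero_or_pos q.natDegree with h | h
      · rw [h]; simp
      · refine (degree_sum_le _ _).trans_lt ?_
        rw [Finset.sup_lt_iff (by exact_mod_cast WithBot.bot_lt_coe _)]
        intro j hj
        exact (degree_C_mul_X_pow_le _ _).trans_lt (by exact_mod_cast Finset.mem_range.1 hj)
    have hQm : Q.Monic := monic_X_pow_add hlt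
    have hQd : Q.natDegree = q.natDegree := by
      rw [natDegree_eq_of_degree_eq_some]
      rw [degree_add_eq_left_of_degree_lt (by rwa [degree_X_pow]), degree_X_pow]
    refine ⟨Q, hQm, hQd, fun j => ?_, ?_⟩
    · have hP'd : ∀ j, (P' j).natDegree ≤ D * d := fun j => by
        refine (natDegree_C_mul_le _ _).trans ((natDegree_comp_le).trans ?_)
        have : (C (2 : K) * X : K[X]).natDegree ≤ 1 := (natDegree_C_mul_le _ _).trans natDegree_X_le
        nlinarith [hPd j]
      simp only [Q, coeff_add, coeff_X_pow, finsetSum_coeff, coeff_C_mul_X_pow]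
      refine natDegree_add_le_of_degree_le ?_ (natDegree_sum_le_of_forall_le _ _ fun k _ => ?_)
      · split_ifs <;> simp
      · split_ifs
        · exact hP'd k
        · simp
    · simp only [Q, Polynomial.map_add, Polynomial.map_pow, map_X, Polynomial.map_sum,
        Polynomial.map_mul, map_C, hP']
      exact hq.as_sum.symm
  have hinj : ∀ g : K[X], g.natDegree < n → φ g = 0 → g = 0 := by
    intro g hg h0
    by_contra hne
    have h1 : aeval pb.gen (g.comp (C (1 / 2) * X)) = 0 := by
      rw [aeval_comp]
      have : aeval pb.gen (C (1 / 2 : K) * X) = pb.gen / 2 := by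
        rw [map_mul, aeval_C, aeval_X, map_div₀, map_one, map_ofNat]; ring
      rw [this]; exact h0
    have h2 : g.comp (C (1 / 2 : K) * X) ≠ 0 := by
      intro h
      rcases comp_eq_zero_iff.1 h with h | ⟨-, h⟩
      · exact hne h
      · have := congrArg (fun g => coeff g 1) h
        simp at this
    have h3 := pb.dim_le_natDegree_of_root h2 h1
    rw [natDegree_comp, hdim] at h3
    have : (C (1 / 2 : K) * X : K[X]).natDegree ≤ 1 := (natDegree_C_mul_le _ _).trans natDegree_X_le
    nlinarith
  rw [hfm.irreducible_iff_natDegree']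
  constructor
  · intro h1
    have : f.natDegree = 0 := by rw [h1]; simp
    rw [hf, hr.natDegree_map] at this
    exact hirr.not_isUnit (by rw [hr.natDegree_eq_zero.1 this]; exact isUnit_one)
  · intro q s hq hs hqs hmem
    obtain ⟨hs0, hsd⟩ := Finset.mem_Ioc.1 hmem
    obtain ⟨Q, hQm, hQd, hQD, hQ⟩ := key q hq (hqs ▸ dvd_mul_right _ _)
    obtain ⟨S, hSm, hSd, hSD, hS⟩ := key s hs (hqs ▸ dvd_mul_left _ _)
    have heq : Q * S = r := by
      rw [← sub_eq_zero]
      ext1 j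
      rw [coeff_zero]
      refine hinj _ ?_ ?_
      · refine lt_of_le_of_lt ?_ (show 2 * (D * d) + D < n by omega)
        rw [coeff_sub, coeff_mul]
        refine natDegree_sub_le_of_le ?_ ((hD j).trans (by omega)) |>.trans (max_self _).le
        refine natDegree_sum_le_of_forall_le _ _ fun x _ => ?_
        refine natDegree_mul_le.trans ?_
        have := hQD x.1
        have := hSD x.2
        omega
      · have : (Q * S - r).map φ = 0 := by
          rw [Polynomial.map_sub, Polynomial.map_mul, hQ, hS, hqs, sub_self]
        rw [← coeff_map, this, coeff_zero]
    rcases hirr.isUnit_or_isUnit heq.symm with h | h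
    · have h1 : Q = 1 := hQm.eq_one_of_isUnit h
      have h2 : f = s := by rw [← hqs, ← hQ, h1]; simp
      rw [h2] at hsd
      have := Nat.div_lt_self (n := s.natDegree) hs0 one_lt_two
      omega
    · have h1 : S = 1 := hSm.eq_one_of_isUnit h
      rw [← hSd, h1] at hs0
      simp at hs0

/-- Evaluation of a bivariate polynomial along a ring homomorphism on the coefficients. -/
noncomputable def biEval {R S : Type*} [CommRing R] [CommRing S] (φ : R →+* S) (x y : S) :
    R[X][X] →+* S :=
  eval₂RingHom (eval₂RingHom φ x) y

theorem biEval_apply {R S : Type*} [CommRing R] [CommRing S] (φ : R →+* S) (x y : S)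
    (p : R[X][X]) : biEval φ x y p = eval₂ (eval₂RingHom φ x) y p := rfl

theorem biEval_C {R S : Type*} [CommRing R] [CommRing S] (φ : R →+* S) (x y : S) (p : R[X]) :
    biEval φ x y (C p) = p.eval₂ φ x := by
  simp [biEval_apply]

theorem biEval_X {R S : Type*} [CommRing R] [CommRing S] (φ : R →+* S) (x y : S) :
    biEval φ x y X = y := by
  simp [biEval_apply]

theorem biEval_map {R R' S : Type*} [CommRing R] [CommRing R'] [CommRing S] (ψ : R →+* R')
    (φ : R' →+* S) (x y : S) (p : R[X][X]) :
    biEval φ x y (p.map (mapRingHom ψ)) = biEval (φ.comp ψ) x y p := by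
  simp only [biEval_apply, eval₂_map]
  congr 1
  ext a <;> simp

theorem map_biEval {R S T : Type*} [CommRing R] [CommRing S] [CommRing T] (φ : R →+* S)
    (σ : S →+* T) (x y : S) (p : R[X][X]) :
    σ (biEval φ x y p) = biEval (σ.comp φ) (σ x) (σ y) p := by
  simp only [biEval_apply, hom_eval₂]
  congr 1
  ext a <;> simp

section Tower

open IntermediateField

theorem exists_biEval_eq_of_mem_adjoin {E Ω : Type*} [Field E] [Field Ω] [Algebra E Ω] {u y : Ω}
    (hu : IsIntegral E u) (hy : IsIntegral E⟮u⟯ y) {z : Ω} (hz : z ∈ E⟮u⟯⟮y⟯) :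
    ∃ S : E[X][X], S.natDegree < (minpoly E⟮u⟯ y).natDegree ∧
      (∀ j, (S.coeff j).natDegree < (minpoly E u).natDegree) ∧
      biEval (algebraMap E Ω) u y S = z := by
  obtain ⟨Q, hQd, hQ⟩ := (adjoin.powerBasis hy).exists_eq_aeval ⟨z, hz⟩
  rw [adjoin.powerBasis_dim] at hQd
  rw [adjoin.powerBasis_gen] at hQ
  have hQz : aeval y Q = z := by
    have := congrArg (algebraMap E⟮u⟯⟮y⟯ Ω) hQ
    rw [← aeval_algebraMap_apply, AdjoinSimple.algebraMap_gen] at this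
    exact this.symm
  have h1 : ∀ a : E⟮u⟯, ∃ P : E[X], P.natDegree < (minpoly E u).natDegree ∧
      aeval u P = (a : Ω) := by
    intro a
    obtain ⟨P, hPd, hP⟩ := (adjoin.powerBasis hu).exists_eq_aeval a
    rw [adjoin.powerBasis_dim] at hPd
    rw [adjoin.powerBasis_gen] at hP
    refine ⟨P, hPd, ?_⟩
    have := congrArg (algebraMap E⟮u⟯ Ω) hP
    rw [← aeval_algebraMap_apply, AdjoinSimple.algebraMap_gen] at this
    exact this.symm
  choose P hPd hP using h1
  have hd0 := minpoly.natDegree_pos hy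
  have hn0 := minpoly.natDegree_pos hu
  set d := (minpoly E⟮u⟯ y).natDegree
  refine ⟨∑ j ∈ Finset.range d, C (P (Q.coeff j)) * X ^ j, ?_, fun j => ?_, ?_⟩
  · refine Nat.lt_of_le_pred hd0 (natDegree_sum_le_of_forall_le _ _ fun j hj => ?_)
    exact (natDegree_C_mul_X_pow_le _ _).trans (Nat.le_pred_of_lt (Finset.mem_range.1 hj))
  · simp only [finsetSum_coeff, coeff_C_mul_X_pow]
    refine Nat.lt_of_le_pred hn0 (natDegree_sum_le_of_forall_le _ _ fun k _ => ?_)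
    split_ifs
    · exact Nat.le_pred_of_lt (hPd _)
    · simp
  · simp only [map_sum, map_mul, biEval_C, map_pow, biEval_X]
    rw [← hQz, aeval_eq_sum_range' hQd]
    refine Finset.sum_congr rfl fun j _ => ?_
    rw [Algebra.smul_def, show eval₂ (algebraMap E Ω) u (P (Q.coeff j)) = _ from hP (Q.coeff j)]
    rfl

theorem eq_zero_of_biEval_eq_zero {E Ω : Type*} [Field E] [Field Ω] [Algebra E Ω] {u y : Ω}
    {S : E[X][X]} (hd : S.natDegree < (minpoly E⟮u⟯ y).natDegree)
    (hn : ∀ j, (S.coeff j).natDegree < (minpoly E u).natDegree)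
    (h : biEval (algebraMap E Ω) u y S = 0) : S = 0 := by
  set ψ : E[X] →+* E⟮u⟯ := (aeval (AdjoinSimple.gen E u) : E[X] →ₐ[E] E⟮u⟯).toRingHom
  have hψ : ∀ p, ((ψ p : E⟮u⟯) : Ω) = aeval u p := fun p => by
    have : aeval (algebraMap E⟮u⟯ Ω (AdjoinSimple.gen E u)) p = algebraMap E⟮u⟯ Ω (ψ p) :=
      aeval_algebraMap_apply ..
    rw [AdjoinSimple.algebraMap_gen] at this
    exact this.symm
  have h0 : aeval y (S.map ψ) = 0 := by
    rw [← h, biEval_apply, aeval_def, eval₂_map]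
    congr 1
    ext a
    · simpa using hψ (C a)
    · simpa using hψ X
  have h1 : S.map ψ = 0 := by
    by_contra hne
    have := natDegree_le_natDegree (minpoly.degree_le_of_ne_zero E⟮u⟯ y hne h0)
    exact absurd (this.trans natDegree_map_le) (not_le.2 hd)
  ext1 j
  rw [coeff_zero]
  by_contra hne
  have h2 : aeval u (S.coeff j) = 0 := by
    rw [← hψ, ← coeff_map, h1]; simp
  exact absurd (natDegree_le_natDegree (minpoly.degree_le_of_ne_zero E u hne h2)) (not_le.2 (hn j))

end Tower

theorem irreducible_X_pow_sub_C_prime {K : Type*} [Field K] [NumberField K] {n p : ℕ}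
    (hn : n.Prime) (hp : p.Prime) (h : Module.finrank ℚ K < n) :
    Irreducible (X ^ n - C (p : K)) := by
  have h0 : Irreducible (X ^ n - C (p : ℚ)) := by
    refine X_pow_sub_C_irreducible_of_prime hn fun b hb => ?_
    have := Fact.mk hp
    have h1 := congrArg (padicValRat p) hb
    rw [padicValRat.pow, padicValRat.self hp.one_lt] at h1
    have h2 : (n : ℤ) ∣ 1 := ⟨_, h1.symm⟩
    exact hn.one_lt.ne' (by exact_mod_cast Int.eq_one_of_dvd_one (by positivity) h2)
  refine X_pow_sub_C_irreducible_of_prime hn fun b hb => ?_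
  have h1 := minpoly.eq_of_irreducible_of_monic h0 (x := b) (by simp [hb])
    (monic_X_pow_sub_C _ hn.ne_zero)
  have h2 := minpoly.natDegree_le (A := ℚ) b
  rw [← h1, natDegree_X_pow_sub_C] at h2
  omega

section Specialize
open IntermediateField

theorem minpoly_eq_map_of_biEval_eq_zero {K Ω : Type*} [Field K] [Field Ω] [Algebra K Ω]
    {u x w : Ω} {x' : K⟮u⟯} (hx : algebraMap K⟮u⟯ Ω x' = x) {r : K[X][X]} (hr : r.Monic)
    (hirr : Irreducible (r.map (aeval x' : K[X] →ₐ[K] K⟮u⟯).toRingHom))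
    (hw : biEval (algebraMap K Ω) x w r = 0) :
    minpoly K⟮u⟯ w = r.map (aeval x' : K[X] →ₐ[K] K⟮u⟯).toRingHom := by
  refine (minpoly.eq_of_irreducible_of_monic hirr ?_ (hr.map _)).symm
  rw [← hw, biEval_apply, aeval_def, eval₂_map]
  congr 1
  ext a
  · simp [← IsScalarTower.algebraMap_apply]
  · simp [hx]

theorem exists_subfield_specialization {E L Ω : Type*} [Field E] [NumberField E] [Field L]
    [NumberField L] [Field Ω] [CharZero Ω] [IsAlgClosed Ω] [Algebra E Ω] [Algebra E L]
    [Algebra L Ω] [IsScalarTower E L Ω] (f : E[X][X]) (hf : f.Monic)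
    (hfL : Irreducible (f.map (mapRingHom (algebraMap E L)))) (rs : List E[X][X])
    (hrs : ∀ r ∈ rs, r.Monic ∧ Irreducible r ∧ f.natDegree < r.natDegree)
    (δ : E[X]) (hδ : δ ≠ 0) :
    ∃ F : Subfield Ω, (∀ e : E, algebraMap E Ω e ∈ F) ∧
      (∀ l : L, algebraMap L Ω l ∈ F → ∃ e, algebraMap E Ω e = algebraMap L Ω l) ∧
      ∃ x ∈ F, ∃ y ∈ F, biEval (algebraMap E Ω) x y f = 0 ∧ δ.eval₂ (algebraMap E Ω) x ≠ 0 ∧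
        ¬ IsIntegral ℤ x ∧ ∀ r ∈ rs, ∀ z ∈ F, biEval (algebraMap E Ω) x z r ≠ 0 := by
  have hfE : Irreducible f := hf.irreducible_of_irreducible_map _ _ hfL
  obtain ⟨nL, hnL⟩ := exists_irreducible_map_aeval L _ (hf.map (mapRingHom (algebraMap E L))) hfL
  have hE : ∃ n₀ : ℕ, ∀ n, n₀ ≤ n → ∃ p₀ : ℕ, ∀ p : ℕ, p.Prime → p₀ ≤ p →
      ∀ r ∈ f :: rs, ∀ (N : Type _) [Field N] [NumberField N] [Algebra E N] (pb : PowerBasis E N),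
      pb.dim = n → pb.gen ^ n = p →
      Irreducible (r.map (aeval (pb.gen / 2) : E[X] →ₐ[E] N).toRingHom) := by
    have hall : ∀ r ∈ f :: rs, r.Monic ∧ Irreducible r := by
      intro r hr
      rcases List.mem_cons.1 hr with rfl | hr
      · exact ⟨hf, hfE⟩
      · exact ⟨(hrs r hr).1, (hrs r hr).2.1⟩
    revert hall
    generalize f :: rs = l
    intro hall
    induction l with
    | nil => exact ⟨0, fun n _ => ⟨0, fun p _ _ r hr => by simp at hr⟩⟩
    | cons r l ih =>
      obtain ⟨n₁, h₁⟩ := ih fun r hr => hall r (List.mem_cons_of_mem _ hr)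
      obtain ⟨n₂, h₂⟩ := exists_irreducible_map_aeval E r (hall r List.mem_cons_self).1
        (hall r List.mem_cons_self).2
      refine ⟨max n₁ n₂, fun n hn => ?_⟩
      obtain ⟨p₁, h₁⟩ := h₁ n (le_of_max_le_left hn)
      obtain ⟨p₂, h₂⟩ := h₂ n (le_of_max_le_right hn)
      refine ⟨max p₁ p₂, fun p hp hpp r' hr' => ?_⟩
      rcases List.mem_cons.1 hr' with rfl | hr'
      · exact h₂ p hp (le_of_max_le_right hpp)
      · exact h₁ p hp (le_of_max_le_left hpp) r' hr'
  obtain ⟨nE, hnE⟩ := hE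
  obtain ⟨n, hn, hnp⟩ := Nat.exists_infinite_primes
    (nL + nE + Module.finrank ℚ L + Module.finrank ℚ E + δ.natDegree + 1)
  obtain ⟨pL, hpL⟩ := hnL n (by omega)
  obtain ⟨pE, hpE⟩ := hnE n (by omega)
  obtain ⟨p, hp, hpp⟩ := Nat.exists_infinite_primes (pL + pE + 3)
  obtain ⟨u, hu⟩ := IsAlgClosed.exists_pow_nat_eq (p : Ω) hnp.pos
  have hminE : minpoly E u = X ^ n - C (p : E) :=
    (minpoly.eq_of_irreducible_of_monic (irreducible_X_pow_sub_C_prime hnp hpp (by omega))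
      (by simp [hu]) (monic_X_pow_sub_C _ hnp.ne_zero)).symm
  have hminL : minpoly L u = X ^ n - C (p : L) :=
    (minpoly.eq_of_irreducible_of_monic (irreducible_X_pow_sub_C_prime hnp hpp (by omega))
      (by simp [hu]) (monic_X_pow_sub_C _ hnp.ne_zero)).symm
  have hdE : (minpoly E u).natDegree = n := by rw [hminE, natDegree_X_pow_sub_C]
  have hdL : (minpoly L u).natDegree = n := by rw [hminL, natDegree_X_pow_sub_C]
  have huE : IsIntegral E u := ⟨X ^ n - C (p : E), monic_X_pow_sub_C _ hnp.ne_zero, by simp [hu]⟩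
  have huL : IsIntegral L u := ⟨X ^ n - C (p : L), monic_X_pow_sub_C _ hnp.ne_zero, by simp [hu]⟩
  have := adjoin.finiteDimensional huE
  have := adjoin.finiteDimensional huL
  have : NumberField E⟮u⟯ :=
    { to_charZero := charZero_of_injective_algebraMap (algebraMap E E⟮u⟯).injective
      to_finiteDimensional := FiniteDimensional.trans ℚ E E⟮u⟯ }
  have : NumberField L⟮u⟯ :=
    { to_charZero := charZero_of_injective_algebraMap (algebraMap L L⟮u⟯).injective
      to_finiteDimensional := FiniteDimensional.trans ℚ L L⟮u⟯ }
  have hirrE := fun r hr => hpE p hpp (by omega) r hr E⟮u⟯ (adjoin.powerBasis huE)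
    (by rw [adjoin.powerBasis_dim, hdE])
    (by
      rw [adjoin.powerBasis_gen]
      apply (algebraMap E⟮u⟯ Ω).injective
      rw [map_pow, AdjoinSimple.algebraMap_gen, hu, map_natCast])
  have hirrL := hpL p hpp (by omega) L⟮u⟯ (adjoin.powerBasis huL)
    (by rw [adjoin.powerBasis_dim, hdL])
    (by
      rw [adjoin.powerBasis_gen]
      apply (algebraMap L⟮u⟯ Ω).injective
      rw [map_pow, AdjoinSimple.algebraMap_gen, hu, map_natCast])
  have hxE : algebraMap E⟮u⟯ Ω ((adjoin.powerBasis huE).gen / 2) = u / 2 := by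
    rw [map_div₀, adjoin.powerBasis_gen, AdjoinSimple.algebraMap_gen, map_ofNat]
  have hxL : algebraMap L⟮u⟯ Ω ((adjoin.powerBasis huL).gen / 2) = u / 2 := by
    rw [map_div₀, adjoin.powerBasis_gen, AdjoinSimple.algebraMap_gen, map_ofNat]
  have hEL : (algebraMap L Ω).comp (algebraMap E L) = algebraMap E Ω :=
    (IsScalarTower.algebraMap_eq E L Ω).symm
  have hfd : f.natDegree ≠ 0 := fun h =>
    hfE.not_isUnit (by rw [hf.natDegree_eq_zero.1 h]; exact isUnit_one)
  obtain ⟨y, hy⟩ : ∃ y, biEval (algebraMap E Ω) (u / 2) y f = 0 := by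
    obtain ⟨y, hy⟩ := IsAlgClosed.exists_root (f.map (eval₂RingHom (algebraMap E Ω) (u / 2))) (by
      rw [hf.degree_map, degree_eq_natDegree hf.ne_zero]; exact_mod_cast hfd)
    exact ⟨y, by rw [biEval_apply, ← eval_map]; exact hy⟩
  have hmyE := minpoly_eq_map_of_biEval_eq_zero hxE hf (hirrE f List.mem_cons_self) hy
  have hmyL := minpoly_eq_map_of_biEval_eq_zero hxL (hf.map _) hirrL
    (w := y) (by rw [biEval_map, hEL, hy])
  have hyE0 : IsIntegral E⟮u⟯ y := by
    rw [← minpoly.ne_zero_iff, hmyE]; exact (hf.map _).ne_zero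
  have hdyE : (minpoly E⟮u⟯ y).natDegree = f.natDegree := by rw [hmyE, hf.natDegree_map]
  have hdyL : (minpoly L⟮u⟯ y).natDegree = f.natDegree := by
    rw [hmyL, (hf.map _).natDegree_map, hf.natDegree_map]
  have := adjoin.finiteDimensional hyE0
  have huF : u ∈ E⟮u⟯⟮y⟯ :=
    E⟮u⟯⟮y⟯.algebraMap_mem (AdjoinSimple.gen E u)
  have hbnd : (Polynomial.C (1 / 2 : E) * X).natDegree ≤ 1 :=
    (natDegree_C_mul_le _ _).trans natDegree_X_le
  refine ⟨E⟮u⟯⟮y⟯.toSubfield, fun e => ?_, fun l hl => ?_, u / 2, ?_, y, ?_, hy, ?_, ?_, ?_⟩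
  · exact E⟮u⟯⟮y⟯.algebraMap_mem (algebraMap E E⟮u⟯ e)
  · obtain ⟨S, hSd, hSn, hS⟩ := exists_biEval_eq_of_mem_adjoin huE hyE0 hl
    refine ⟨(S.coeff 0).coeff 0, ?_⟩
    have h0 : S.map (mapRingHom (algebraMap E L)) - C (C l) = 0 := by
      refine eq_zero_of_biEval_eq_zero (u := u) (y := y) ?_ (fun j => ?_) ?_
      · rw [hdyL, ← hdyE]
        refine (natDegree_sub_le _ _).trans_lt (max_lt (natDegree_map_le.trans_lt hSd) ?_)
        rw [natDegree_C]; omega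
      · rw [hdL, ← hdE, coeff_sub, coeff_map]
        refine (natDegree_sub_le _ _).trans_lt (max_lt (natDegree_map_le.trans_lt (hSn j)) ?_)
        rw [coeff_C]
        split_ifs
        · rw [natDegree_C]; exact minpoly.natDegree_pos huE
        · rw [natDegree_zero]; exact minpoly.natDegree_pos huE
      · rw [map_sub, biEval_map, hEL, hS, biEval_C, eval₂_C, sub_self]
    have h1 := congrArg (fun q => (coeff q 0).coeff 0) h0
    simp only [coeff_sub, coeff_map, coeff_C_zero, coe_mapRingHom, coeff_zero] at h1
    rw [IsScalarTower.algebraMap_apply E L Ω, sub_eq_zero.1 h1]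
  · exact E⟮u⟯⟮y⟯.div_mem huF (ofNat_mem _ 2)
  · exact mem_adjoin_simple_self _ y
  · intro h
    have h1 : aeval u (δ.comp (C (1 / 2) * X)) = 0 := by
      rw [aeval_comp]
      have : aeval u (C (1 / 2 : E) * X) = u / 2 := by
        rw [map_mul, aeval_C, aeval_X, map_div₀, map_one, map_ofNat]; ring
      rw [this]; exact h
    have h2 : δ.comp (C (1 / 2 : E) * X) ≠ 0 := by
      intro h
      rcases comp_eq_zero_iff.1 h with h | ⟨-, h⟩
      · exact hδ h
      · have := congrArg (fun g => coeff g 1) h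
        simp at this
    have h3 := natDegree_le_natDegree (minpoly.degree_le_of_ne_zero E u h2 h1)
    rw [hdE, natDegree_comp] at h3
    nlinarith
  · intro h
    have h1 : IsIntegral ℤ (algebraMap ℚ Ω ((p : ℚ) / 2 ^ n)) := by
      have := h.pow n
      rw [div_pow, hu] at this
      simpa using this
    rw [isIntegral_algebraMap_iff (algebraMap ℚ Ω).injective] at h1
    obtain ⟨k, hk⟩ := IsIntegrallyClosed.isIntegral_iff.1 h1
    have h2 : (p : ℚ) = k * 2 ^ n := by
      rw [eq_div_iff (by positivity)] at hk
      rw [← hk]; simp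
    have h3 : (p : ℤ) = k * 2 ^ n := by exact_mod_cast h2
    have h4 : (2 : ℤ) ∣ p := h3 ▸ Dvd.dvd.mul_left (dvd_pow_self 2 hnp.ne_zero) k
    have h5 := (Nat.prime_dvd_prime_iff_eq Nat.prime_two hpp).1 (by exact_mod_cast h4)
    omega
  · intro r hr z hz h
    have hmr := minpoly_eq_map_of_biEval_eq_zero hxE (hrs r hr).1
      (hirrE r (List.mem_cons_of_mem _ hr)) h
    have h1 := minpoly.natDegree_le (A := E⟮u⟯) (⟨z, hz⟩ : E⟮u⟯⟮y⟯)
    rw [adjoin.finrank hyE0, hdyE, ← minpoly.algebraMap_eq (algebraMap E⟮u⟯⟮y⟯ Ω).injective] at h1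
    change (minpoly E⟮u⟯ z).natDegree ≤ _ at h1
    rw [hmr, (hrs r hr).1.natDegree_map] at h1
    exact absurd (hrs r hr).2.2 (not_lt.2 h1)

end Specialize

/-- A two-dimensional Hilbertian-type property of a field `F` inside a field `Ω`: absolutely
irreducible plane curves monic in the second variable have `F`-points, outside any given finite set
of fibres and over a non-integral abscissa, which do not lift to given covers of larger degree. -/
def ThinlyHilbertian (F Ω : Type*) [Field F] [Field Ω] [Algebra F Ω] : Prop :=
  ∀ (f : F[X][X]) (rs : List F[X][X]) (δ : F[X]), f.Monic →
    Irreducible (f.map (mapRingHom (algebraMap F Ω))) → δ ≠ 0 →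
    (∀ r ∈ rs, r.Monic ∧ Irreducible r ∧ f.natDegree < r.natDegree) →
    ∃ x y : F, biEval (RingHom.id F) x y f = 0 ∧ δ.eval x ≠ 0 ∧ ¬ IsIntegral ℤ x ∧
      ∀ r ∈ rs, ∀ z, biEval (RingHom.id F) x z r ≠ 0

theorem isAlgebraic_qbar : Algebra.IsAlgebraic ℚ Qbar := by
  have h := AlgebraicClosure.isAlgebraic ℚ
  rwa [Subsingleton.elim (AlgebraicClosure.instAlgebra ℚ) DivisionRing.toRatAlgebra] at h

theorem countable_qbar : Countable Qbar := by
  have := isAlgebraic_qbar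
  rw [← Cardinal.mk_le_aleph0_iff]
  exact (Algebra.IsAlgebraic.cardinalMk_le_max ℚ Qbar).trans
    (max_le (Cardinal.mk_le_aleph0_iff.2 inferInstance) le_rfl)

theorem countable_polynomial (R : Type*) [Semiring R] [Countable R] : Countable R[X] := by
  rw [← Cardinal.mk_le_aleph0_iff]
  exact cardinalMk_le_max.trans (max_le (Cardinal.mk_le_aleph0_iff.2 inferInstance) le_rfl)

theorem isOpen_setOf_mem (a : Qbar) : IsOpen {F : Subfield Qbar | a ∈ F} := by
  let := propDiscrete
  let := powersetTopology
  have : DiscreteTopology Prop := ⟨rfl⟩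
  refine isOpen_induced_iff.2 ⟨(fun s : Set Qbar => a ∈ s) ⁻¹' {True}, ?_, by ext; simp⟩
  exact (isOpen_discrete ({True} : Set Prop)).preimage
    (continuous_apply (A := fun _ : Qbar => Prop) a)

theorem isOpen_setOf_notMem (a : Qbar) : IsOpen {F : Subfield Qbar | a ∉ F} := by
  let := propDiscrete
  let := powersetTopology
  have : DiscreteTopology Prop := ⟨rfl⟩
  refine isOpen_induced_iff.2 ⟨(fun s : Set Qbar => a ∈ s) ⁻¹' {False}, ?_, by ext; simp⟩
  exact (isOpen_discrete ({False} : Set Prop)).preimage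
    (continuous_apply (A := fun _ : Qbar => Prop) a)

theorem exists_finset_of_isOpen {V : Set (Subfield Qbar)} (hV : IsOpen V) {F : Subfield Qbar}
    (hF : F ∈ V) : ∃ T : Finset Qbar, ∀ F' : Subfield Qbar, (∀ a ∈ T, a ∈ F' ↔ a ∈ F) → F' ∈ V := by
  let := propDiscrete
  obtain ⟨U, hU, rfl⟩ := (@isOpen_induced_iff _ _ powersetTopology _ _).1 hV
  obtain ⟨I, u, hu, hI⟩ := isOpen_pi_iff.1 hU (F : Set Qbar) hF
  refine ⟨I, fun F' h => hI fun a ha => ?_⟩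
  have : (F' : Set Qbar) a = (F : Set Qbar) a := propext (h a ha)
  exact cast (congrArg (u a) this.symm) (hu a ha).2

theorem exists_map_mapRingHom_eq {R S : Type*} [CommRing R] [CommRing S] (φ : R →+* S)
    (p : S[X][X]) (h : ∀ i j, (p.coeff i).coeff j ∈ Set.range φ) :
    ∃ q : R[X][X], q.map (mapRingHom φ) = p := by
  have : p ∈ lifts (mapRingHom φ) := by
    rw [lifts_iff_coeff_lifts]
    intro i
    exact (lifts_iff_coeff_lifts _).2 (h i)
  exact this

theorem monic_of_map_mapRingHom {R S : Type*} [Field R] [Field S] (φ : R →+* S)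
    {p : R[X][X]} (h : (p.map (mapRingHom φ)).Monic) : p.Monic :=
  monic_of_injective (map_injective φ φ.injective) h

/-- The subfields over which the given data, which are defined over the subfield, violate
`ThinlyHilbertian`. -/
def violatingSet (d : Qbar[X][X] × List Qbar[X][X] × Qbar[X]) : Set (Subfield Qbar) :=
  {F | ∃ (f : F[X][X]) (rs : List F[X][X]) (δ : F[X]),
    f.map (mapRingHom F.subtype) = d.1 ∧ rs.map (Polynomial.map (mapRingHom F.subtype)) = d.2.1 ∧
    δ.map F.subtype = d.2.2 ∧ f.Monic ∧
    Irreducible (f.map (mapRingHom F.subtype)) ∧ δ ≠ 0 ∧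
    (∀ r ∈ rs, r.Monic ∧ Irreducible r ∧ f.natDegree < r.natDegree) ∧
    ¬ ∃ x y : F, biEval (RingHom.id F) x y f = 0 ∧ δ.eval x ≠ 0 ∧ ¬ IsIntegral ℤ x ∧
      ∀ r ∈ rs, ∀ z, biEval (RingHom.id F) x z r ≠ 0}

theorem numberField_intermediateField {Ω : Type*} [Field Ω] [CharZero Ω]
    (L : IntermediateField ℚ Ω) [FiniteDimensional ℚ L] : NumberField L :=
  { to_charZero := charZero_of_injective_algebraMap (algebraMap ℚ L).injective
    to_finiteDimensional := by convert ‹FiniteDimensional ℚ L› }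

theorem numberField_of_ringHom {E L : Type*} [Field E] [Field L] [NumberField L] (i : E →+* L) :
    NumberField E := by
  have : CharZero E := (i.charZero_iff i.injective).2 inferInstance
  let := i.toAlgebra
  exact { to_finiteDimensional := FiniteDimensional.left ℚ E L }

theorem isNowhereDense_violatingSet (d : Qbar[X][X] × List Qbar[X][X] × Qbar[X]) :
    IsNowhereDense (violatingSet d) := by
  classical
  rw [IsNowhereDense]
  by_contra hne
  obtain ⟨F₀, hF₀⟩ := Set.nonempty_iff_ne_empty.2 hne
  set V := interior (closure (violatingSet d)) with hV
  have hVo : IsOpen V := isOpen_interior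
  obtain ⟨F, hFV, hFd⟩ := mem_closure_iff.1 (interior_subset hF₀) V hVo hF₀
  obtain ⟨f, rs, δ, hfd, hrd, hδd, hf, hfΩ, hδ, hrs, -⟩ := hFd
  obtain ⟨T, hT⟩ := exists_finset_of_isOpen hVo hFV
  let cf : Qbar[X][X] → Finset Qbar := fun p => p.coeffs.biUnion Polynomial.coeffs
  have hcf : ∀ (p : Qbar[X][X]) i j, (p.coeff i).coeff j ∈ insert 0 (cf p) := by
    intro p i j
    by_cases h : (p.coeff i).coeff j = 0
    · rw [h]; exact Finset.mem_insert_self _ _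
    · refine Finset.mem_insert_of_mem (Finset.mem_biUnion.2 ⟨p.coeff i, ?_, ?_⟩)
      · exact coeff_mem_coeffs fun h0 => h (by rw [h0, coeff_zero])
      · exact coeff_mem_coeffs h
  let A : Finset Qbar := T ∪ insert 0 (cf d.1) ∪
    (d.2.1.toFinset.biUnion fun r => insert 0 (cf r)) ∪ insert 0 (cf (C d.2.2))
  let L : IntermediateField ℚ Qbar := IntermediateField.adjoin ℚ (A : Set Qbar)
  have : FiniteDimensional ℚ L := IntermediateField.finiteDimensional_adjoin fun x _ =>
    (isAlgebraic_qbar.isAlgebraic x).isIntegral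
  have : NumberField L := numberField_intermediateField L
  have hAL : ∀ a ∈ A, a ∈ L := fun a ha => IntermediateField.subset_adjoin _ _ ha
  let E : Subfield Qbar := F ⊓ L.toSubfield
  have hEF : E ≤ F := inf_le_left
  have hEL : E ≤ L.toSubfield := inf_le_right
  let iL : E →+* L := Subfield.inclusion hEL
  let iF : E →+* F := Subfield.inclusion hEF
  have : NumberField E := numberField_of_ringHom iL
  let : Algebra E L := iL.toAlgebra
  have : IsScalarTower E L Qbar := IsScalarTower.of_algebraMap_eq fun _ => rfl
  have hlift : ∀ p : F[X][X], (∀ i j, ((p.coeff i).coeff j : Qbar) ∈ A) →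
      ∃ q : E[X][X], q.map (mapRingHom iF) = p := by
    intro p hp
    exact exists_map_mapRingHom_eq iF p fun i j =>
      ⟨⟨_, (p.coeff i |>.coeff j).2, hAL _ (hp i j)⟩, rfl⟩
  have hcoe : ∀ (p : F[X][X]) (P : Qbar[X][X]), p.map (mapRingHom F.subtype) = P →
      ∀ i j, ((p.coeff i).coeff j : Qbar) = (P.coeff i).coeff j := by
    rintro p P rfl i j
    simp
  have hcomp : ∀ (q : E[X][X]) (p : F[X][X]), q.map (mapRingHom iF) = p →
      q.map (mapRingHom (algebraMap E Qbar)) = p.map (mapRingHom F.subtype) := by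
    rintro q p rfl
    rw [Polynomial.map_map, mapRingHom_comp]
    rfl
  obtain ⟨f', hf'⟩ := hlift f fun i j => by
    rw [hcoe f _ hfd]
    exact Finset.mem_union_left _ (Finset.mem_union_left _ (Finset.mem_union_right _ (hcf _ i j)))
  obtain ⟨δ', hδ'⟩ : ∃ δ' : E[X], δ'.map iF = δ := by
    obtain ⟨q, hq⟩ := hlift (C δ) fun i j => by
      rw [hcoe (C δ) (C d.2.2) (by rw [map_C, coe_mapRingHom, hδd])]
      exact Finset.mem_union_right _ (hcf _ i j)
    refine ⟨q.coeff 0, ?_⟩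
    have := congrArg (fun p => coeff p 0) hq
    simpa using this
  have hrs' : ∀ r ∈ rs, ∃ r' : E[X][X], r'.map (mapRingHom iF) = r := fun r hr => hlift r fun i j => by
    rw [hcoe r _ rfl]
    refine Finset.mem_union_left _ (Finset.mem_union_right _ (Finset.mem_biUnion.2
      ⟨r.map (mapRingHom F.subtype), ?_, hcf _ i j⟩))
    rw [List.mem_toFinset, ← hrd]
    exact List.mem_map_of_mem hr
  choose! ρ hρ using hrs'
  have hfm : f'.Monic := monic_of_map_mapRingHom iF (hf' ▸ hf)
  have hnat : ∀ q : E[X][X], (q.map (mapRingHom iF)).natDegree = q.natDegree := fun q =>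
    natDegree_map_eq_of_injective (map_injective iF iF.injective) q
  obtain ⟨E₁, hE₁, hL₁, x, hx, y, hy, hxy, hxδ, hxi, hxr⟩ :=
    exists_subfield_specialization (E := E) (L := L) (Ω := Qbar) f' hfm (by
      refine (hfm.map _).irreducible_of_irreducible_map (mapRingHom (algebraMap L Qbar)) _ ?_
      rw [Polynomial.map_map, mapRingHom_comp, ← IsScalarTower.algebraMap_eq, hcomp f' f hf']
      exact hfΩ) (rs.map ρ) (by
      intro r' hr'
      obtain ⟨r, hr, rfl⟩ := List.mem_map.1 hr'
      obtain ⟨h1, h2, h3⟩ := hrs r hr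
      have hm : (ρ r).Monic := monic_of_map_mapRingHom iF (by rw [hρ r hr]; exact h1)
      refine ⟨hm, hm.irreducible_of_irreducible_map (mapRingHom iF) _ (by rw [hρ r hr]; exact h2), ?_⟩
      rwa [← hf', ← hρ r hr, hnat, hnat] at h3) δ' (by
      rintro rfl
      exact hδ (by rw [← hδ', Polynomial.map_zero]))
  have hE₁V : E₁ ∈ V := by
    refine hT E₁ fun a ha => ?_
    have haL : a ∈ L := hAL a (Finset.mem_union_left _ (Finset.mem_union_left _
      (Finset.mem_union_left _ ha)))
    constructor
    · intro h
      obtain ⟨e, he⟩ := hL₁ ⟨a, haL⟩ h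
      change (e : Qbar) = a at he
      rw [← he]
      exact hEF e.2
    · intro h
      exact hE₁ ⟨a, h, haL⟩
  have hδx : δ.map F.subtype = δ'.map (algebraMap E Qbar) := by
    rw [← hδ', Polynomial.map_map]; rfl
  let Z : Finset Qbar := d.2.1.toFinset.biUnion fun r =>
    (r.map (eval₂RingHom (RingHom.id Qbar) x)).roots.toFinset
  have hrm : ∀ r ∈ d.2.1, r.Monic := by
    intro r hr
    rw [← hrd] at hr
    obtain ⟨r', hr', rfl⟩ := List.mem_map.1 hr
    exact (hrs r' hr').1.map _
  have hZ : ∀ z, z ∈ Z ↔ ∃ r ∈ d.2.1, biEval (RingHom.id Qbar) x z r = 0 := by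
    intro z
    simp only [Z, Finset.mem_biUnion, List.mem_toFinset, Multiset.mem_toFinset]
    refine exists_congr fun r => and_congr_right fun hr => ?_
    rw [mem_roots ((hrm r hr).map _).ne_zero, IsRoot, eval_map]
    rfl
  let W : Set (Subfield Qbar) := V ∩ {G | x ∈ G} ∩ {G | y ∈ G} ∩ ⋂ z ∈ Z, {G | z ∉ G}
  have hW : IsOpen W := ((hVo.inter (isOpen_setOf_mem x)).inter (isOpen_setOf_mem y)).inter
    (isOpen_biInter_finset fun z _ => isOpen_setOf_notMem z)
  have hE₁W : E₁ ∈ W := by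
    refine ⟨⟨⟨hE₁V, hx⟩, hy⟩, ?_⟩
    rw [Set.mem_iInter₂]
    intro z hz hzE
    obtain ⟨r, hr, hrz⟩ := (hZ z).1 hz
    rw [← hrd] at hr
    obtain ⟨r', hr', rfl⟩ := List.mem_map.1 hr
    refine hxr (ρ r') (List.mem_map_of_mem hr') z hzE ?_
    rw [← hcomp (ρ r') r' (hρ r' hr'), biEval_map, RingHom.id_comp] at hrz
    exact hrz
  obtain ⟨G, hGW, hGd⟩ := mem_closure_iff.1 (interior_subset hE₁V) W hW hE₁W
  obtain ⟨⟨⟨-, hxG⟩, hyG⟩, hGZ⟩ := hGW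
  obtain ⟨g, ss, ε, hgd, hsd, hεd, -, -, -, -, hno⟩ := hGd
  have hG : ∀ (a b : G) (p : G[X][X]), ((biEval (RingHom.id G) a b p : G) : Qbar) =
      biEval (RingHom.id Qbar) a b (p.map (mapRingHom G.subtype)) := by
    intro a b p
    rw [biEval_map, RingHom.id_comp]
    exact map_biEval (RingHom.id G) G.subtype a b p
  refine hno ⟨⟨x, hxG⟩, ⟨y, hyG⟩, ?_, ?_, ?_, ?_⟩
  · apply Subtype.ext
    rw [hG, hgd, ← hfd, ← hcomp f' f hf', biEval_map, RingHom.id_comp]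
    exact hxy
  · intro h
    apply hxδ
    have h1 := congrArg G.subtype h
    rw [← eval_map_apply, hεd, ← hδd, hδx, eval_map, map_zero] at h1
    exact h1
  · intro h
    exact hxi (h.map (IsScalarTower.toAlgHom ℤ G Qbar))
  · intro s hs z h
    have h1 := congrArg G.subtype h
    rw [map_zero] at h1
    refine Set.mem_iInter₂.1 hGZ z ((hZ z).2 ⟨s.map (mapRingHom G.subtype), ?_, ?_⟩) z.2
    · rw [← hsd]; exact List.mem_map_of_mem hs
    · rw [← hG ⟨x, hxG⟩ z s]; exact h1

theorem isMeagre_not_thinlyHilbertian :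
    IsMeagre {F : Subfield Qbar | ¬ ThinlyHilbertian F Qbar} := by
  have := countable_qbar
  have := countable_polynomial Qbar
  have := countable_polynomial Qbar[X]
  refine (isMeagre_iUnion fun d => (isNowhereDense_violatingSet d).isMeagre).mono fun F hF => ?_
  simp only [ThinlyHilbertian, Set.mem_ofPred_eq, not_forall] at hF
  obtain ⟨f, rs, δ, h1, h2, h3, h4, h5⟩ := hF
  exact Set.mem_iUnion.2 ⟨(f.map (mapRingHom F.subtype), rs.map (Polynomial.map (mapRingHom F.subtype)),
    δ.map F.subtype), f, rs, δ, rfl, rfl, rfl, h1, h2, h3, h4, h5⟩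

open Filter in
theorem exists_forall_eventually_of_finite {V C : Type*} [Nonempty V] [Countable C]
    {l : Filter ℕ} (hl : l ≤ atTop) (P : C → ℕ → V → Prop)
    (h : ∀ s : Finset C, ∀ᶠ i in l, ∃ v, ∀ c ∈ s, P c i v) :
    ∃ v : ℕ → V, ∀ c, ∀ᶠ i in l, P c i (v i) := by
  classical
  rcases isEmpty_or_nonempty C with hC | hC
  · exact ⟨fun _ => Classical.arbitrary V, fun c => hC.elim c⟩
  obtain ⟨e, he⟩ := exists_surjective_nat C
  have key : ∀ i, ∃ v : V, ∀ n ≤ i, (∃ v, ∀ c ∈ (Finset.range (n + 1)).image e, P c i v) →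
      (∃ m, n ≤ m ∧ ∀ c ∈ (Finset.range (m + 1)).image e, P c i v) := by
    intro i
    by_cases hne : ∃ n ≤ i, ∃ v, ∀ c ∈ (Finset.range (n + 1)).image e, P c i v
    · obtain ⟨v, hv⟩ := Nat.findGreatest_spec (P := fun n =>
        ∃ v, ∀ c ∈ (Finset.range (n + 1)).image e, P c i v) hne.choose_spec.1 hne.choose_spec.2
      exact ⟨v, fun n hn h => ⟨_, Nat.le_findGreatest hn h, hv⟩⟩
    · exact ⟨Classical.arbitrary V, fun n hn h => (hne ⟨n, hn, h⟩).elim⟩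
  choose v hv using key
  refine ⟨v, fun c => ?_⟩
  obtain ⟨n, rfl⟩ := he c
  filter_upwards [h ((Finset.range (n + 1)).image e), hl (eventually_ge_atTop n)] with i h1 h2
  obtain ⟨m, hm, h⟩ := hv i n h2 h1
  exact h _ (Finset.mem_image_of_mem _ (Finset.mem_range.2 (by omega)))

/-- The nonprincipal ultrapower of a type over `ℕ`. -/
def Ultrapower (κ : Type*) := ((Filter.hyperfilter ℕ : Ultrafilter ℕ) : Filter ℕ).Germ κ

noncomputable instance (κ : Type*) [Field κ] : Field (Ultrapower κ) :=
  inferInstanceAs (Field (((Filter.hyperfilter ℕ : Ultrafilter ℕ) : Filter ℕ).Germ κ))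

/-- The quotient map from sequences to the ultrapower. -/
noncomputable def toUltrapower (κ : Type*) [Field κ] : (ℕ → κ) →+* Ultrapower κ :=
  Filter.Germ.coeRingHom _

theorem toUltrapower_surjective (κ : Type*) [Field κ] : Function.Surjective (toUltrapower κ) :=
  fun z => Filter.Germ.inductionOn z fun u => ⟨u, rfl⟩

theorem toUltrapower_eq_iff {κ : Type*} [Field κ] {u v : ℕ → κ} :
    toUltrapower κ u = toUltrapower κ v ↔ ∀ᶠ i in Filter.hyperfilter ℕ, u i = v i :=
  Filter.Germ.coe_eq

theorem toUltrapower_eq_zero_iff {κ : Type*} [Field κ] {u : ℕ → κ} :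
    toUltrapower κ u = 0 ↔ ∀ᶠ i in Filter.hyperfilter ℕ, u i = 0 := by
  rw [← map_zero (toUltrapower κ), toUltrapower_eq_iff]; rfl

theorem map_toUltrapower_eq_zero_iff {κ : Type*} [Field κ] {p : (ℕ → κ)[X]} :
    p.map (toUltrapower κ) = 0 ↔
      ∀ᶠ i in Filter.hyperfilter ℕ, p.map (Pi.evalRingHom (fun _ => κ) i) = 0 := by
  constructor
  · intro h
    have h1 : ∀ᶠ i in Filter.hyperfilter ℕ, ∀ j ∈ p.support, p.coeff j i = 0 := by
      refine (Filter.eventually_all_finset p.support).2 fun j _ => ?_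
      rw [← toUltrapower_eq_zero_iff, ← coeff_map, h, coeff_zero]
    filter_upwards [h1] with i hi
    ext j
    by_cases hj : j ∈ p.support
    · simpa using hi j hj
    · simp [notMem_support_iff.1 hj]
  · intro h
    ext j
    rw [coeff_map, coeff_zero, toUltrapower_eq_zero_iff]
    filter_upwards [h] with i hi
    simpa using congrArg (fun q => q.coeff j) hi

theorem map_map_toUltrapower_eq_zero_iff {κ : Type*} [Field κ] {p : (ℕ → κ)[X][X]} :
    p.map (mapRingHom (toUltrapower κ)) = 0 ↔
      ∀ᶠ i in Filter.hyperfilter ℕ,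
        p.map (mapRingHom (Pi.evalRingHom (fun _ => κ) i)) = 0 := by
  constructor
  · intro h
    have h1 : ∀ᶠ i in Filter.hyperfilter ℕ, ∀ j ∈ p.support,
        (p.coeff j).map (Pi.evalRingHom (fun _ => κ) i) = 0 := by
      refine (Filter.eventually_all_finset p.support).2 fun j _ => ?_
      rw [← map_toUltrapower_eq_zero_iff, ← coe_mapRingHom, ← coeff_map, h, coeff_zero]
    filter_upwards [h1] with i hi
    ext1 j
    by_cases hj : j ∈ p.support
    · simpa using hi j hj
    · simp [notMem_support_iff.1 hj]
  · intro h
    ext1 j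
    rw [coeff_map, coeff_zero, coe_mapRingHom, map_toUltrapower_eq_zero_iff]
    filter_upwards [h] with i hi
    simpa using congrArg (fun q => q.coeff j) hi

theorem biEval_toUltrapower {κ : Type*} [Field κ] (p : (ℕ → κ)[X][X]) (x y : ℕ → κ) :
    biEval (RingHom.id _) (toUltrapower κ x) (toUltrapower κ y)
      (p.map (mapRingHom (toUltrapower κ))) = 0 ↔
    ∀ᶠ i in Filter.hyperfilter ℕ, biEval (RingHom.id κ) (x i) (y i)
      (p.map (mapRingHom (Pi.evalRingHom (fun _ => κ) i))) = 0 := by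
  have h := map_biEval (RingHom.id _) (toUltrapower κ) x y p
  rw [biEval_map, RingHom.id_comp, ← RingHom.comp_id (toUltrapower κ)]
  refine (iff_of_eq (congrArg (· = 0) h.symm)).trans ?_
  rw [toUltrapower_eq_zero_iff]
  refine Filter.eventually_congr (Filter.Eventually.of_forall fun i => ?_)
  have h' := map_biEval (RingHom.id _) (Pi.evalRingHom (fun _ => κ) i) x y p
  rw [biEval_map, RingHom.id_comp, ← RingHom.comp_id (Pi.evalRingHom (fun _ => κ) i)]
  change Pi.evalRingHom (fun _ => κ) i (biEval (RingHom.id (ℕ → κ)) x y p) = 0 ↔ _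
  rw [h']
  rfl

theorem coeff_coeff_swap {R : Type*} [CommRing R] (p : R[X][X]) (j k : ℕ) :
    ((Bivariate.swap p).coeff j).coeff k = (p.coeff k).coeff j := by
  induction p using Polynomial.induction_on' with
  | add p q hp hq => simp [hp, hq]
  | monomial n f =>
    induction f using Polynomial.induction_on' with
    | add p q hp hq => simp_all [map_add]
    | monomial m a =>
      rw [Bivariate.swap_monomial_monomial]
      simp only [coeff_monomial]
      by_cases h1 : m = j <;> by_cases h2 : n = k <;> simp [h1, h2, coeff_monomial]

theorem natDegree_coeff_le_of_dvd {κ : Type*} [Field κ] {f p : κ[X][X]} (hp : p ≠ 0) (h : f ∣ p)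
    {N : ℕ} (hN : ∀ j, (p.coeff j).natDegree ≤ N) (j : ℕ) : (f.coeff j).natDegree ≤ N := by
  have h1 : (Bivariate.swap p).natDegree ≤ N := by
    rw [natDegree_le_iff_coeff_eq_zero]
    intro n hn
    ext k
    rw [coeff_coeff_swap, coeff_zero]
    exact coeff_eq_zero_of_natDegree_lt ((hN k).trans_lt hn)
  have h2 : (Bivariate.swap f).natDegree ≤ N :=
    (natDegree_le_of_dvd (_root_.map_dvd Bivariate.swap h) (by
      rwa [Ne, EmbeddingLike.map_eq_zero_iff])).trans h1
  rw [natDegree_le_iff_coeff_eq_zero]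
  intro n hn
  rw [← coeff_coeff_swap, coeff_eq_zero_of_natDegree_lt (h2.trans_lt hn), coeff_zero]

theorem exists_monic_lift {κ : Type*} [Field κ] (d N : ℕ) (f : ℕ → κ[X][X]) :
    ∃ F : (ℕ → κ)[X][X], F.Monic ∧ F.natDegree = d ∧ ∀ i, (f i).Monic → (f i).natDegree = d →
      (∀ j, ((f i).coeff j).natDegree ≤ N) →
      F.map (mapRingHom (Pi.evalRingHom (fun _ => κ) i)) = f i := by
  set G : (ℕ → κ)[X][X] := ∑ j ∈ Finset.range d, monomial j
    (∑ k ∈ Finset.range (N + 1), monomial k (fun i => ((f i).coeff j).coeff k)) with hG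
  have hGd : G.degree < d := by
    refine (degree_sum_le _ _).trans_lt ?_
    refine (Finset.sup_lt_iff (WithBot.bot_lt_coe d)).2 fun j hj => ?_
    exact (degree_monomial_le _ _).trans_lt (WithBot.coe_lt_coe.2 (Finset.mem_range.1 hj))
  refine ⟨X ^ d + G, monic_X_pow_add hGd, natDegree_eq_of_degree_eq_some ?_, ?_⟩
  · rw [degree_add_eq_left_of_degree_lt (by rwa [degree_X_pow]), degree_X_pow]
  intro i hm hd hN
  conv_rhs => rw [hm.as_sum, hd]
  rw [Polynomial.map_add, Polynomial.map_pow, map_X, hG, Polynomial.map_sum]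
  congr 1
  refine Finset.sum_congr rfl fun j _ => ?_
  rw [map_monomial, coe_mapRingHom, Polynomial.map_sum, C_mul_X_pow_eq_monomial]
  congr 1
  rw [((f i).coeff j).as_sum_range' (N + 1) (Nat.lt_succ_of_le (hN j))]
  exact Finset.sum_congr rfl fun k _ => by rw [map_monomial]; simp

theorem eventually_irreducible_map {κ : Type*} [Field κ] {p : (ℕ → κ)[X][X]} (hp : p.Monic)
    (h : Irreducible (p.map (mapRingHom (toUltrapower κ)))) :
    ∀ᶠ i in Filter.hyperfilter ℕ,
      Irreducible (p.map (mapRingHom (Pi.evalRingHom (fun _ => κ) i))) := by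
  set ev := fun i => mapRingHom (Pi.evalRingHom (fun _ : ℕ => κ) i) with hev
  by_contra hcon
  rw [← Ultrafilter.eventually_not] at hcon
  have hp1 : p ≠ 1 := by
    rintro rfl
    rw [Polynomial.map_one] at h
    exact h.1 isUnit_one
  have hn : 0 < p.natDegree := by
    rw [Nat.pos_iff_ne_zero, Ne, hp.natDegree_eq_zero]
    exact hp1
  have hnd : ∀ i, (p.map (ev i)).natDegree = p.natDegree := fun i => hp.natDegree_map _
  have key : ∀ i, ∃ f g : κ[X][X], ¬ Irreducible (p.map (ev i)) → f.Monic ∧ g.Monic ∧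
      f * g = p.map (ev i) ∧ g.natDegree ∈ Finset.Ioc 0 (p.natDegree / 2) := by
    intro i
    by_cases hi : Irreducible (p.map (ev i))
    · exact ⟨0, 0, fun h => (h hi).elim⟩
    · rw [(hp.map (ev i)).irreducible_iff_natDegree'] at hi
      push Not at hi
      have hne : p.map (ev i) ≠ 1 := fun h1 => by
        have := hnd i
        rw [h1, natDegree_one] at this
        omega
      obtain ⟨f, g, hf, hg, hfg, hd⟩ := hi hne
      rw [hnd i] at hd
      exact ⟨f, g, fun _ => ⟨hf, hg, hfg, hd⟩⟩
  choose f g hfg using key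
  have h2 : ∀ᶠ i in Filter.hyperfilter ℕ, ∃ e ∈ (Finset.Ioc 0 (p.natDegree / 2) : Set ℕ),
      (g i).natDegree = e := by
    filter_upwards [hcon] with i hi
    exact ⟨_, (hfg i hi).2.2.2, rfl⟩
  obtain ⟨e, he, h3⟩ := (Ultrafilter.eventually_exists_mem_iff (Finset.finite_toSet _)).1 h2
  have he' : 0 < e ∧ e ≤ p.natDegree / 2 := by simpa using he
  set N := p.support.sup fun j => (p.coeff j).natDegree with hNdef
  have hN : ∀ i j, ((p.map (ev i)).coeff j).natDegree ≤ N := by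
    intro i j
    rw [coeff_map]
    refine (natDegree_map_le).trans ?_
    by_cases hj : j ∈ p.support
    · exact Finset.le_sup (f := fun j => (p.coeff j).natDegree) hj
    · simp [notMem_support_iff.1 hj]
  obtain ⟨F, hF, hFd, hFm⟩ := exists_monic_lift (p.natDegree - e) N f
  obtain ⟨G, hG, hGd, hGm⟩ := exists_monic_lift e N g
  have h4 : (F * G - p).map (mapRingHom (toUltrapower κ)) = 0 := by
    rw [map_map_toUltrapower_eq_zero_iff]
    filter_upwards [hcon, h3] with i hi hie
    obtain ⟨h5, h6, h7, -⟩ := hfg i hi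
    have hp0 : p.map (ev i) ≠ 0 := (hp.map _).ne_zero
    have h8 : (f i).natDegree = p.natDegree - e := by
      have := congrArg natDegree h7
      rw [h5.natDegree_mul h6, hnd, hie] at this
      omega
    rw [Polynomial.map_sub, Polynomial.map_mul,
      hFm i h5 h8 (natDegree_coeff_le_of_dvd hp0 (Dvd.intro _ h7) (hN i)),
      hGm i h6 hie (natDegree_coeff_le_of_dvd hp0 (Dvd.intro_left _ h7) (hN i)), h7, sub_self]
  rw [Polynomial.map_sub, Polynomial.map_mul, sub_eq_zero] at h4
  rcases h.isUnit_or_isUnit h4.symm with hu | hu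
  · have := congrArg natDegree ((hF.map (mapRingHom (toUltrapower κ))).eq_one_of_isUnit hu)
    rw [hF.natDegree_map, natDegree_one] at this
    omega
  · have := congrArg natDegree ((hG.map (mapRingHom (toUltrapower κ))).eq_one_of_isUnit hu)
    rw [hG.natDegree_map, natDegree_one] at this
    omega

/-- The image of `φ` is relatively algebraically closed. -/
def RelAlgClosed {A M : Type*} [Field A] [Field M] (φ : A →+* M) : Prop :=
  ∀ (z : M) (p : A[X]), p ≠ 0 → p.eval₂ φ z = 0 → z ∈ Set.range φ

theorem Polynomial.Monic.irreducible_map_of_lifts {R S : Type*} [CommRing R] [IsDomain R]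
    [CommRing S] [IsDomain S] {φ : R →+* S} (hφ : Function.Injective φ) {p : R[X]} (hp : p.Monic)
    (hirr : Irreducible p) (h : ∀ g : S[X], g.Monic → g ∣ p.map φ → g ∈ lifts φ) :
    Irreducible (p.map φ) := by
  have hp1 : p.map φ ≠ 1 := by
    intro h1
    rw [← Polynomial.map_one φ] at h1
    rw [map_injective φ hφ h1] at hirr
    exact hirr.1 isUnit_one
  refine (irreducible_of_monic (hp.map φ) hp1).2 fun f g hf hg hfg => ?_
  obtain ⟨f', rfl, -, hf'⟩ := lifts_and_natDegree_eq_and_monic (h f hf (Dvd.intro _ hfg)) hf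
  obtain ⟨g', rfl, -, hg'⟩ := lifts_and_natDegree_eq_and_monic (h g hg (Dvd.intro_left _ hfg)) hg
  rw [← Polynomial.map_mul] at hfg
  rcases hirr.isUnit_or_isUnit (map_injective φ hφ hfg).symm with hu | hu
  · left; rw [hf'.eq_one_of_isUnit hu, Polynomial.map_one]
  · right; rw [hg'.eq_one_of_isUnit hu, Polynomial.map_one]

theorem RelAlgClosed.coeff_mem_range {A M : Type*} [Field A] [Field M] {φ : A →+* M}
    (hφ : RelAlgClosed φ) {p : A[X]} (hp : p.Monic) {g : M[X]} (hg : g.Monic) (h : g ∣ p.map φ)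
    (j : ℕ) : g.coeff j ∈ Set.range φ := by
  let := φ.toAlgebra
  obtain ⟨P, hP, hP0⟩ := isIntegral_coeff_of_dvd (S := M) p g hp hg h j
  exact hφ _ P hP.ne_zero hP0

theorem RelAlgClosed.irreducible_map {A M : Type*} [Field A] [Field M] {φ : A →+* M}
    (hφ : RelAlgClosed φ) {p : A[X]} (hp : p.Monic) (hirr : Irreducible p) :
    Irreducible (p.map φ) :=
  hp.irreducible_map_of_lifts φ.injective hirr fun g hg hgp => by
    rw [lifts_iff_coeff_lifts]
    exact hφ.coeff_mem_range hp hg hgp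

theorem mem_lifts_of_forall_eval_mem_range {A M : Type*} [Field A] [Infinite A] [Field M]
    {φ : A →+* M} {p : M[X]} (h : ∀ a, p.eval (φ a) ∈ Set.range φ) : p ∈ lifts φ := by
  classical
  choose r hr using h
  obtain ⟨s, hs⟩ := Infinite.exists_subset_card_eq A (p.natDegree + 1)
  have hinj : Set.InjOn φ s := φ.injective.injOn
  have hd : p.degree < s.card := by
    rw [hs]
    exact degree_le_natDegree.trans_lt (WithBot.coe_lt_coe.2 (Nat.lt_succ_self _))
  rw [Lagrange.eq_interpolate_of_eval_eq (fun a => φ (r a)) (s := s) (v := φ) hinj hd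
    fun i _ => (hr i).symm]
  rw [Lagrange.interpolate_apply]
  refine Subsemiring.sum_mem _ fun i hi => mul_mem ⟨C (r i), by simp⟩ ?_
  simp only [Lagrange.basis, Lagrange.basisDivisor]
  refine Subsemiring.prod_mem _ fun j hj => mul_mem ⟨C (i - j)⁻¹, by simp⟩ ⟨X - C j, by simp⟩

theorem RelAlgClosed.irreducible_map_map {A M : Type*} [Field A] [Infinite A] [Field M]
    {φ : A →+* M} (hφ : RelAlgClosed φ) {p : A[X][X]} (hp : p.Monic) (hirr : Irreducible p) :
    Irreducible (p.map (mapRingHom φ)) :=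
  hp.irreducible_map_of_lifts (map_injective φ φ.injective) hirr fun g hg hgp => by
    rw [lifts_iff_coeff_lifts]
    intro j
    obtain ⟨q, hq⟩ : g.coeff j ∈ lifts φ := by
      refine mem_lifts_of_forall_eval_mem_range fun a => ?_
      have h1 : g.map (evalRingHom (φ a)) ∣ (p.map (evalRingHom a)).map φ := by
        have := Polynomial.map_dvd (evalRingHom (φ a)) hgp
        rw [Polynomial.map_map] at this ⊢
        convert! this using 2
        ext <;> simp
      simpa using hφ.coeff_mem_range (hp.map _) (hg.map _) h1 j
    exact ⟨q, hq⟩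

theorem biEval_eq_sum {R S : Type*} [CommRing R] [CommRing S] (φ : R →+* S) (x y : S)
    (p : R[X][X]) {d e : ℕ} (hd : p.natDegree < d) (he : ∀ j, (p.coeff j).natDegree < e) :
    biEval φ x y p = ∑ j ∈ Finset.range d, ∑ k ∈ Finset.range e,
      φ ((p.coeff j).coeff k) * (x ^ k * y ^ j) := by
  rw [biEval_apply, eval₂_eq_sum_range' _ hd]
  refine Finset.sum_congr rfl fun j _ => ?_
  rw [coe_eval₂RingHom, eval₂_eq_sum_range' _ (he j), Finset.sum_mul]
  exact Finset.sum_congr rfl fun k _ => by ring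

theorem exists_generator_of_finite {A k : Type*} [Field A] [CharZero A] [Field k] [Algebra A k]
    [Algebra.IsAlgebraic A k] (T : Set k) (hT : T.Finite) :
    ∃ θ : k, ∀ s ∈ T, ∃ P : A[X], P.natDegree < (minpoly A θ).natDegree ∧ aeval θ P = s := by
  have := hT.to_subtype
  have : FiniteDimensional A (IntermediateField.adjoin A T) :=
    IntermediateField.finiteDimensional_adjoin fun x _ => Algebra.IsIntegral.isIntegral x
  obtain ⟨θ, hθ⟩ := Field.exists_primitive_element A (IntermediateField.adjoin A T)
  have hθi : IsIntegral A θ := Algebra.IsIntegral.isIntegral θ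
  refine ⟨θ, fun s hs => ?_⟩
  have h1 : (⟨s, IntermediateField.subset_adjoin A T hs⟩ : IntermediateField.adjoin A T) ∈
      IntermediateField.adjoin A {θ} := by rw [hθ]; trivial
  rw [← IntermediateField.mem_toSubalgebra,
    IntermediateField.adjoin_simple_toSubalgebra_of_isAlgebraic hθi.isAlgebraic,
    Algebra.adjoin_singleton_eq_range_aeval] at h1
  obtain ⟨P, hP⟩ := h1
  have e : minpoly A (θ : k) = minpoly A θ :=
    minpoly.algebraMap_eq (algebraMap (IntermediateField.adjoin A T) k).injective θ
  refine ⟨P %ₘ minpoly A θ, ?_, ?_⟩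
  · rw [e]
    refine natDegree_modByMonic_lt _ (minpoly.monic hθi) (minpoly.ne_one A θ)
  · have h2 : aeval (θ : k) P = s := by
      have := congrArg (algebraMap (IntermediateField.adjoin A T) k) hP
      simpa [← aeval_algebraMap_apply] using this
    rw [← h2, ← e]
    exact aeval_modByMonic_eq_self_of_root (minpoly.aeval A _)

theorem irreducible_map_of_isAlgebraic {A M k : Type*} [Field A] [CharZero A] [Field M] [Field k]
    [Algebra A k] [Algebra.IsAlgebraic A k] {φ : A →+* M} (hφ : RelAlgClosed φ) {f : A[X][X]}
    (hf : f.Monic) {b c : M} (hbc : biEval φ b c f = 0)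
    (hmin : ∀ q : A[X][X], biEval φ b c q = 0 → q.natDegree < f.natDegree → q = 0) :
    Irreducible (f.map (mapRingHom (algebraMap A k))) := by
  let := φ.toAlgebra
  let L := AlgebraicClosure M
  let τ : M →+* L := algebraMap M L
  let σ : k →ₐ[A] L := IsAlgClosed.lift
  have hτ : τ.comp φ = σ.toRingHom.comp (algebraMap A k) := by
    ext a
    exact ((IsScalarTower.algebraMap_apply A M L a).symm.trans (σ.commutes a).symm)
  have hfd : 0 < f.natDegree := by
    rw [Nat.pos_iff_ne_zero, Ne, hf.natDegree_eq_zero]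
    rintro rfl
    simp at hbc
  have key : ∀ g : k[X][X], biEval σ.toRingHom (τ b) (τ c) g = 0 → g.natDegree < f.natDegree →
      g = 0 := by
    intro g hg hgd
    obtain ⟨e, he⟩ : ∃ e, ∀ j, (g.coeff j).natDegree < e := by
      refine ⟨(g.support.sup fun j => (g.coeff j).natDegree) + 1, fun j => ?_⟩
      by_cases hj : j ∈ g.support
      · exact Nat.lt_succ_of_le (Finset.le_sup (f := fun j => (g.coeff j).natDegree) hj)
      · simp [notMem_support_iff.1 hj]
    obtain ⟨θ, hθ⟩ := exists_generator_of_finite (A := A)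
      ((fun x : ℕ × ℕ => (g.coeff x.1).coeff x.2) ''
        ((Finset.range f.natDegree ×ˢ Finset.range e : Finset (ℕ × ℕ)) : Set (ℕ × ℕ)))
      (Set.Finite.image _ (Finset.finite_toSet _))
    have hθ' : ∀ j k, ∃ P : A[X], P.natDegree < (minpoly A θ).natDegree ∧
        (j < f.natDegree → k < e → aeval θ P = (g.coeff j).coeff k) := by
      intro j k
      by_cases h : j < f.natDegree ∧ k < e
      · obtain ⟨P, h1, h2⟩ := hθ _ ⟨(j, k), by simpa using h, rfl⟩
        exact ⟨P, h1, fun _ _ => h2⟩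
      · exact ⟨0, by simpa using minpoly.natDegree_pos (Algebra.IsIntegral.isIntegral θ),
          fun h1 h2 => (h ⟨h1, h2⟩).elim⟩
    choose P hPd hP using hθ'
    have hm : minpoly M (σ θ) = (minpoly A θ).map φ := by
      refine (minpoly.eq_of_irreducible_of_monic (hφ.irreducible_map
        (minpoly.monic (Algebra.IsIntegral.isIntegral θ))
        (minpoly.irreducible (Algebra.IsIntegral.isIntegral θ))) ?_
        ((minpoly.monic (Algebra.IsIntegral.isIntegral θ)).map _)).symm
      change aeval (σ θ) ((minpoly A θ).map (algebraMap A M)) = 0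
      rw [aeval_map_algebraMap, aeval_algHom_apply, minpoly.aeval, map_zero]
    have hE : ∑ j ∈ Finset.range f.natDegree, ∑ k ∈ Finset.range e,
        (P j k).map φ * C (b ^ k * c ^ j) = 0 := by
      by_contra hne
      refine hne (eq_zero_of_dvd_of_natDegree_lt (minpoly.dvd M (σ θ) ?_) ?_)
      · rw [biEval_eq_sum _ _ _ _ hgd he] at hg
        rw [map_sum, ← hg]
        refine Finset.sum_congr rfl fun j hj => ?_
        rw [map_sum]
        refine Finset.sum_congr rfl fun k hk => ?_
        rw [map_mul, aeval_C, map_mul, map_pow, map_pow,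
          ← hP j k (Finset.mem_range.1 hj) (Finset.mem_range.1 hk)]
        congr 1
        change aeval (σ θ) ((P j k).map (algebraMap A M)) = _
        rw [aeval_map_algebraMap, aeval_algHom_apply]
        rfl
      · rw [hm, natDegree_map]
        refine lt_of_le_of_lt (natDegree_sum_le_of_forall_le (n := (minpoly A θ).natDegree - 1)
          _ _ fun j _ => natDegree_sum_le_of_forall_le _ _ fun k _ =>
          (natDegree_mul_C_le _ _).trans (natDegree_map_le.trans ?_)) ?_
        · exact Nat.le_pred_of_lt (hPd j k)
        · have := minpoly.natDegree_pos (Algebra.IsIntegral.isIntegral (R := A) θ)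
          omega
    have hP0 : ∀ t j k, j < f.natDegree → k < e → (P j k).coeff t = 0 := by
      intro t
      set q : A[X][X] := ∑ j ∈ Finset.range f.natDegree, ∑ k ∈ Finset.range e,
        monomial j (monomial k ((P j k).coeff t)) with hq
      have hq0 : q = 0 := by
        refine hmin q ?_ ?_
        · have := congrArg (fun r => r.coeff t) hE
          simp only [finsetSum_coeff, coeff_mul_C, coeff_map, coeff_zero] at this
          rw [hq, map_sum, ← this]
          refine Finset.sum_congr rfl fun j _ => ?_
          rw [map_sum]
          refine Finset.sum_congr rfl fun k _ => ?_
          simp [biEval_apply, eval₂_monomial, mul_assoc]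
        · refine lt_of_le_of_lt (natDegree_sum_le_of_forall_le (n := f.natDegree - 1)
            _ _ fun j hj => natDegree_sum_le_of_forall_le _ _ fun k _ =>
            (natDegree_monomial_le _).trans ?_) ?_
          · exact Nat.le_pred_of_lt (Finset.mem_range.1 hj)
          · omega
      intro j k hj hk
      have := congrArg (fun r => (r.coeff j).coeff k) hq0
      simp only [hq, finsetSum_coeff, coeff_monomial, coeff_zero] at this
      rw [Finset.sum_eq_single j, Finset.sum_eq_single k] at this
      · simpa using this
      · intro k' _ hk'
        simp [coeff_monomial, hk']
      · intro h
        exact (h (Finset.mem_range.2 hk)).elim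
      · intro j' _ hj'
        simp [hj']
      · intro h
        exact (h (Finset.mem_range.2 hj)).elim
    ext j k
    rw [coeff_zero, coeff_zero]
    rcases lt_or_ge j f.natDegree with hj | hj
    · rcases lt_or_ge k e with hk | hk
      · rw [← hP j k hj hk, show P j k = 0 from ext fun t => by rw [hP0 t j k hj hk, coeff_zero],
          map_zero]
      · exact coeff_eq_zero_of_natDegree_lt ((he j).trans_le hk)
    · rw [coeff_eq_zero_of_natDegree_lt (hgd.trans_le hj), coeff_zero]
  have hfm := hf.map (mapRingHom (algebraMap A k))
  refine (irreducible_of_monic hfm fun h1 => ?_).2 fun g h hg hh hgh => ?_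
  · have := congrArg natDegree h1
    rw [hf.natDegree_map, natDegree_one] at this
    omega
  · have h1 : biEval σ.toRingHom (τ b) (τ c) g * biEval σ.toRingHom (τ b) (τ c) h = 0 := by
      rw [← map_mul, hgh, biEval_map, ← hτ, ← map_biEval, hbc, map_zero]
    have h2 := congrArg natDegree hgh
    rw [hg.natDegree_mul hh, hf.natDegree_map] at h2
    rcases mul_eq_zero.1 h1 with h3 | h3
    · right
      by_contra h4
      rw [← hh.natDegree_eq_zero] at h4
      exact hg.ne_zero (key g h3 (by omega))
    · left
      by_contra h4
      rw [← hg.natDegree_eq_zero] at h4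
      exact hh.ne_zero (key h h3 (by omega))

/-- A plane curve with a generic point in a field in which the base is relatively algebraically
closed is absolutely irreducible. -/
theorem irreducible_map_of_relAlgClosed {A M W : Type*} [Field A] [CharZero A] [Field M] [Field W]
    {φ : A →+* M} (hφ : RelAlgClosed φ) {f : A[X][X]} (hf : f.Monic) {b c : M}
    (hbc : biEval φ b c f = 0)
    (hmin : ∀ q : A[X][X], biEval φ b c q = 0 → q.natDegree < f.natDegree → q = 0)
    (χ : A →+* W) : Irreducible (f.map (mapRingHom χ)) := by
  let := χ.toAlgebra
  have h1 := irreducible_map_of_isAlgebraic (k := algebraicClosure A W) hφ hf hbc hmin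
  have h2 : RelAlgClosed (algebraMap (algebraicClosure A W) W) := by
    intro z p hp hz
    have h3 : IsAlgebraic (algebraicClosure A W) z := ⟨p, hp, hz⟩
    exact ⟨⟨z, mem_algebraicClosure_iff.2 (h3.restrictScalars A)⟩, rfl⟩
  have : CharZero (algebraicClosure A W) := charZero_of_injective_algebraMap
    (algebraMap A (algebraicClosure A W)).injective
  have := h2.irreducible_map_map (hf.map _) h1
  rwa [Polynomial.map_map, mapRingHom_comp] at this

theorem exists_isIntegral_adjoin_eq_top (R k E : Type*) [CommRing R] [IsDomain R]
    [IsIntegrallyClosed R] [Field k] [CharZero k] [Algebra R k] [IsFractionRing R k] [Field E]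
    [Algebra R E] [Algebra k E] [IsScalarTower R k E] [FiniteDimensional k E] :
    ∃ c : E, IsIntegral R c ∧ IntermediateField.adjoin k {c} = ⊤ ∧
      (minpoly R c).natDegree = Module.finrank k E := by
  obtain ⟨θ, hθ⟩ := Field.exists_primitive_element k E
  have hθi : IsAlgebraic R θ :=
    (IsFractionRing.isAlgebraic_iff R k E).2 (Algebra.IsAlgebraic.isAlgebraic θ)
  obtain ⟨y, hy0, hy⟩ := hθi.exists_integral_multiple
  have hyk : algebraMap R k y ≠ 0 := by
    rwa [Ne, IsFractionRing.to_map_eq_zero_iff]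
  have htop : IntermediateField.adjoin k {y • θ} = ⊤ := by
    rw [eq_top_iff, ← hθ, IntermediateField.adjoin_simple_le_iff]
    have h1 : θ = algebraMap k E (algebraMap R k y)⁻¹ * (y • θ) := by
      rw [Algebra.smul_def, IsScalarTower.algebraMap_apply R k E, ← mul_assoc, ← map_mul,
        inv_mul_cancel₀ hyk, map_one, one_mul]
    have h2 := mul_mem (IntermediateField.algebraMap_mem (IntermediateField.adjoin k {y • θ})
      (algebraMap R k y)⁻¹) (IntermediateField.mem_adjoin_simple_self k (y • θ))
    rwa [← h1] at h2
  refine ⟨y • θ, hy, htop, ?_⟩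
  rw [← (Field.primitive_element_iff_minpoly_natDegree_eq k _).1 htop,
    minpoly.isIntegrallyClosed_eq_field_fractions' k hy, (minpoly.monic hy).natDegree_map]

theorem exists_irreducible_eval₂_eq_mul (R k : Type*) {N : Type*} [CommRing R] [IsDomain R]
    [IsIntegrallyClosed R] [Field k] [CharZero k] [Algebra R k] [IsFractionRing R k] [Field N]
    [Algebra R N] [Algebra k N] [IsScalarTower R k N] [FiniteDimensional k N] (h : N[X])
    (hm : h.Monic) (hirr : Irreducible h) (hd : 2 ≤ h.natDegree)
    (hinj : Function.Injective (algebraMap R N)) :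
    ∃ r : R[X], r.Monic ∧ Irreducible r ∧ Module.finrank k N < r.natDegree ∧
      ∃ G g : N[X], eval₂ (C.comp (algebraMap R N)) G r = h * g := by
  have : Fact (Irreducible h) := ⟨hirr⟩
  have hfin : Module.finrank N (AdjoinRoot h) = h.natDegree := by
    rw [(AdjoinRoot.powerBasis hm.ne_zero).finrank, AdjoinRoot.powerBasis_dim]
  have : FiniteDimensional N (AdjoinRoot h) := (AdjoinRoot.powerBasis hm.ne_zero).finite
  have : FiniteDimensional k (AdjoinRoot h) := FiniteDimensional.trans k N _
  obtain ⟨w, hw, -, hwd⟩ := exists_isIntegral_adjoin_eq_top R k (AdjoinRoot h)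
  have : FaithfulSMul R (AdjoinRoot h) := by
    rw [faithfulSMul_iff_algebraMap_injective, IsScalarTower.algebraMap_eq R N (AdjoinRoot h),
      RingHom.coe_comp]
    exact (algebraMap N (AdjoinRoot h)).injective.comp hinj
  refine ⟨minpoly R w, minpoly.monic hw, minpoly.irreducible hw, ?_, ?_⟩
  · rw [hwd, ← Module.finrank_mul_finrank k N (AdjoinRoot h), hfin]
    have : 0 < Module.finrank k N := Module.finrank_pos
    nlinarith
  · obtain ⟨G, hG⟩ := AdjoinRoot.mk_surjective w
    have h1 : AdjoinRoot.mk h (eval₂ (C.comp (algebraMap R N)) G (minpoly R w)) = 0 := by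
      rw [hom_eval₂, hG, ← minpoly.aeval R w, aeval_def]
      congr 1
    obtain ⟨g, hg⟩ := AdjoinRoot.mk_eq_zero.1 h1
    exact ⟨G, g, hg⟩

theorem exists_integral_primitive_element {R M : Type*} [CommRing R] [IsDomain R]
    [IsIntegrallyClosed R] [Field M] [CharZero M] [Algebra R M] [FaithfulSMul R M] {S : Set M}
    (hS : S.Finite) (halg : ∀ s ∈ S, IsAlgebraic R s) :
    ∃ (N : Subfield M) (f : R[X]) (c : M), S ⊆ N ∧ f.Monic ∧ aeval c f = 0 ∧
      (∀ P : R[X], aeval c P = 0 → f ∣ P) ∧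
      (∀ s ∈ N, ∃ D : R, D ≠ 0 ∧ ∃ P : R[X], algebraMap R M D * s = aeval c P) ∧
      ∀ h : M[X], h.Monic → Irreducible h → 2 ≤ h.natDegree → (∀ k, h.coeff k ∈ N) →
        ∃ r : R[X], r.Monic ∧ Irreducible r ∧ f.natDegree < r.natDegree ∧
          ∃ G g : M[X], (∀ k, G.coeff k ∈ N) ∧ (∀ k, g.coeff k ∈ N) ∧
            eval₂ (C.comp (algebraMap R M)) G r = h * g := by
  let k := FractionRing R
  let : Algebra k M := FractionRing.liftAlgebra R M
  have : IsScalarTower R k M := FractionRing.isScalarTower_liftAlgebra R M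
  have : CharZero k := (algebraMap k M).charZero
  let N := IntermediateField.adjoin k S
  have := hS.to_subtype
  have : FiniteDimensional k N := IntermediateField.finiteDimensional_adjoin fun x hx =>
    ((IsFractionRing.isAlgebraic_iff R k M).1 (halg x hx)).isIntegral
  obtain ⟨c, hc, hctop, hcd⟩ := exists_isIntegral_adjoin_eq_top R k N
  have hRN : IsScalarTower R N M := IsScalarTower.of_algebraMap_eq fun x => by
    rw [IsScalarTower.algebraMap_apply R k N, IsScalarTower.algebraMap_apply R k M]
    rfl
  have hinj : Function.Injective (algebraMap R N) := by
    refine Function.Injective.of_comp (f := algebraMap N M) ?_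
    rw [← RingHom.coe_comp, ← IsScalarTower.algebraMap_eq]
    exact FaithfulSMul.algebraMap_injective R M
  have haeval : ∀ P : R[X], aeval (c : M) P = (aeval c P : N) := fun P =>
    aeval_algebraMap_apply M c P
  refine ⟨N.toSubfield, minpoly R c, c, IntermediateField.subset_adjoin k S, minpoly.monic hc, ?_,
    ?_, ?_, ?_⟩
  · rw [haeval, minpoly.aeval]; rfl
  · intro P hP
    rw [haeval] at hP
    have : FaithfulSMul R N := (faithfulSMul_iff_algebraMap_injective R N).2 hinj
    exact minpoly.isIntegrallyClosed_dvd hc (Subtype.ext hP)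
  · intro s hs
    have hci : IsAlgebraic k c := Algebra.IsAlgebraic.isAlgebraic c
    have h1 : (⟨s, hs⟩ : N) ∈ IntermediateField.adjoin k {c} := by rw [hctop]; trivial
    rw [← IntermediateField.mem_toSubalgebra,
      IntermediateField.adjoin_simple_toSubalgebra_of_isAlgebraic hci,
      Algebra.adjoin_singleton_eq_range_aeval] at h1
    obtain ⟨Q, hQ⟩ := h1
    obtain ⟨D, hD, hDQ⟩ := IsLocalization.integerNormalization_spec (nonZeroDivisors R) Q
    refine ⟨D, nonZeroDivisors.ne_zero hD, IsLocalization.integerNormalization (nonZeroDivisors R) Q,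
      ?_⟩
    have h2 : aeval (c : M) Q = s := by
      rw [← IntermediateField.algebraMap_apply N c, aeval_algebraMap_apply]
      exact congrArg (algebraMap N M) hQ
    rw [← aeval_map_algebraMap k, hDQ, ← h2]
    rw [← algebraMap_smul k D Q, map_smul, algebraMap_smul, Algebra.smul_def]
  · intro h hm hirr hd hN
    obtain ⟨h', rfl, -, hm'⟩ := lifts_and_natDegree_eq_and_monic (f := algebraMap N M) (p := h)
      ((lifts_iff_coeff_lifts _).2 fun j => ⟨⟨_, hN j⟩, rfl⟩) hm
    have hirr' := Monic.irreducible_of_irreducible_map _ h' hm' hirr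
    rw [natDegree_map] at hd
    obtain ⟨r, hr, hri, hrd, G, g, hg⟩ :=
      exists_irreducible_eval₂_eq_mul R k h' hm' hirr' hd hinj
    refine ⟨r, hr, hri, by rwa [hcd], G.map (algebraMap N M), g.map (algebraMap N M),
      fun j => ?_, fun j => ?_, ?_⟩
    · rw [coeff_map]; exact (G.coeff j).2
    · rw [coeff_map]; exact (g.coeff j).2
    · rw [← Polynomial.map_mul, ← hg, ← coe_mapRingHom, hom_eval₂]
      congr 1
      ext a
      simp [IsScalarTower.algebraMap_apply R N M]

theorem exists_ringHom_of_ker_le {P M M' : Type*} [CommRing P] [Field M] [Field M'] (Φ : P →+* M)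
    (Ψ : P →+* M') (hker : ∀ p, Φ p = 0 → Ψ p = 0) {D : P} (hΦ : Φ D ≠ 0) (hΨ : Ψ D ≠ 0) :
    ∃ (Λ : Subring M) (ψ : Λ →+* M'), (∀ p, ∃ h : Φ p ∈ Λ, ψ ⟨Φ p, h⟩ = Ψ p) ∧
      ∀ s p, Φ D * s = Φ p → s ∈ Λ := by
  let Φ' : Localization.Away D →+* M := IsLocalization.Away.lift D (isUnit_iff_ne_zero.2 hΦ)
  let Ψ' : Localization.Away D →+* M' := IsLocalization.Away.lift D (isUnit_iff_ne_zero.2 hΨ)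
  have hΦ' : ∀ p, Φ' (algebraMap P _ p) = Φ p := fun p => IsLocalization.Away.lift_eq _ _ p
  have hΨ' : ∀ p, Ψ' (algebraMap P _ p) = Ψ p := fun p => IsLocalization.Away.lift_eq _ _ p
  have hk : ∀ z, Φ' z = 0 → Ψ' z = 0 := by
    intro z hz
    obtain ⟨n, p, hp⟩ := IsLocalization.Away.surj D z
    have h1 := congrArg Φ' hp
    rw [map_mul, hz, zero_mul, hΦ'] at h1
    have h2 := congrArg Ψ' hp
    rw [hΨ', hker p h1.symm, map_mul, map_pow, hΨ'] at h2
    exact (mul_eq_zero.1 h2).resolve_right (pow_ne_zero n hΨ)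
  let ψ := Φ'.rangeRestrict.liftOfSurjective Φ'.rangeRestrict_surjective
    ⟨Ψ', fun z hz => hk z (congrArg Subtype.val hz)⟩
  have hψ : ∀ z, ψ (Φ'.rangeRestrict z) = Ψ' z := fun z =>
    RingHom.liftOfRightInverse_comp_apply _ _ _ _ z
  refine ⟨Φ'.range, ψ, fun p => ⟨⟨algebraMap P _ p, hΦ' p⟩, ?_⟩, fun s p hs => ?_⟩
  · rw [← hΨ' p, ← hψ]
    congr 1
    exact Subtype.ext (hΦ' p).symm
  · refine ⟨algebraMap P _ p * IsLocalization.Away.invSelf D, ?_⟩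
    have h1 : Φ' (IsLocalization.Away.invSelf D) * Φ D = 1 := by
      rw [← hΦ', ← map_mul, mul_comm, IsLocalization.Away.mul_invSelf, map_one]
    rw [map_mul, hΦ', ← hs, mul_right_comm, mul_comm (Φ D), h1, one_mul]

theorem exists_common_denominator {R M : Type*} [CommRing R] [IsDomain R] [Field M] [Algebra R M]
    {N : Set M} {c : M}
    (hN : ∀ s ∈ N, ∃ D : R, D ≠ 0 ∧ ∃ P : R[X], algebraMap R M D * s = aeval c P) {T : Set M}
    (hT : T.Finite) (hTN : T ⊆ N) :
    ∃ D : R, D ≠ 0 ∧ ∀ s ∈ T, ∃ P : R[X], algebraMap R M D * s = aeval c P := by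
  induction T, hT using Set.Finite.induction_on with
  | empty => exact ⟨1, one_ne_zero, by simp⟩
  | @insert a T _ _ ih =>
    obtain ⟨D, hD, h⟩ := ih ((Set.subset_insert a T).trans hTN)
    obtain ⟨D', hD', P', hP'⟩ := hN a (hTN (Set.mem_insert a T))
    refine ⟨D * D', mul_ne_zero hD hD', ?_⟩
    rintro s (rfl | hs)
    · exact ⟨C D * P', by rw [map_mul, map_mul, aeval_C, mul_assoc, hP']⟩
    · obtain ⟨P, hP⟩ := h s hs
      exact ⟨C D' * P, by rw [map_mul, map_mul, aeval_C, mul_right_comm, hP, mul_comm]⟩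

/-- The map induced on ultrapowers by a homomorphism of fields. -/
noncomputable def Ultrapower.map {κ μ : Type*} [Field κ] [Field μ] (φ : κ →+* μ) :
    Ultrapower κ →+* Ultrapower μ :=
  (toUltrapower κ).liftOfSurjective (toUltrapower_surjective κ)
    ⟨(toUltrapower μ).comp (φ.compLeft ℕ), fun u hu => by
      rw [RingHom.mem_ker, toUltrapower_eq_zero_iff] at hu
      rw [RingHom.mem_ker, RingHom.comp_apply, toUltrapower_eq_zero_iff]
      filter_upwards [hu] with i hi
      simp [hi]⟩

theorem Ultrapower.map_comp_toUltrapower {κ μ : Type*} [Field κ] [Field μ] (φ : κ →+* μ) :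
    (Ultrapower.map φ).comp (toUltrapower κ) = (toUltrapower μ).comp (φ.compLeft ℕ) :=
  RingHom.liftOfRightInverse_comp _ _ _ _

theorem exists_monic_toUltrapower_lift {κ : Type*} [Field κ] {p : (Ultrapower κ)[X][X]}
    (hp : p.Monic) : ∃ q : (ℕ → κ)[X][X], q.Monic ∧ q.natDegree = p.natDegree ∧
      q.map (mapRingHom (toUltrapower κ)) = p := by
  have h : p ∈ lifts (mapRingHom (toUltrapower κ)) := by
    rw [lifts_iff_coeff_lifts]
    exact fun j => map_surjective _ (toUltrapower_surjective κ) _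
  obtain ⟨q, hq, hd, hm⟩ := lifts_and_natDegree_eq_and_monic h hp
  exact ⟨q, hm, hd, hq⟩

theorem ThinlyHilbertian.exists_generic_point {K Ω : Type*} [Field K] [Field Ω] [Algebra K Ω]
    (hK : ThinlyHilbertian K Ω) {f : (Ultrapower K)[X][X]} (hf : f.Monic)
    (hfi : Irreducible (f.map (mapRingHom (Ultrapower.map (algebraMap K Ω)))))
    {δ : (Ultrapower K)[X]} (hδ : δ ≠ 0) {rs : Set (Ultrapower K)[X][X]} (hrs : rs.Finite)
    (hr : ∀ r ∈ rs, r.Monic ∧ Irreducible r ∧ f.natDegree < r.natDegree) :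
    ∃ (x : ℕ → K) (y : Ultrapower K),
      biEval (RingHom.id _) (toUltrapower K x) y f = 0 ∧ δ.eval (toUltrapower K x) ≠ 0 ∧
      (∀ᶠ i in Filter.hyperfilter ℕ, ¬ IsIntegral ℤ (x i)) ∧
      ∀ r ∈ rs, ∀ z, biEval (RingHom.id _) (toUltrapower K x) z r ≠ 0 := by
  set ev := fun i => Pi.evalRingHom (fun _ : ℕ => K) i with hev
  obtain ⟨f', hf', hfd, rfl⟩ := exists_monic_toUltrapower_lift hf
  obtain ⟨δ', rfl⟩ := map_surjective _ (toUltrapower_surjective K) δ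
  have hlift : ∀ r : (Ultrapower K)[X][X], ∃ q : (ℕ → K)[X][X], r.Monic → q.Monic ∧
      q.natDegree = r.natDegree ∧ q.map (mapRingHom (toUltrapower K)) = r := by
    intro r
    by_cases h : r.Monic
    · obtain ⟨q, hq⟩ := exists_monic_toUltrapower_lift h
      exact ⟨q, fun _ => hq⟩
    · exact ⟨0, fun h' => (h h').elim⟩
  choose L hL using hlift
  have h1 : ∀ᶠ i in Filter.hyperfilter ℕ,
      Irreducible ((f'.map (mapRingHom (ev i))).map (mapRingHom (algebraMap K Ω))) := by
    have : Irreducible ((f'.map (mapRingHom ((algebraMap K Ω).compLeft ℕ))).map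
        (mapRingHom (toUltrapower Ω))) := by
      rwa [Polynomial.map_map, mapRingHom_comp, ← Ultrapower.map_comp_toUltrapower,
        ← mapRingHom_comp, ← Polynomial.map_map]
    filter_upwards [eventually_irreducible_map (hf'.map _) this] with i hi
    rwa [Polynomial.map_map, mapRingHom_comp] at hi ⊢
  have h2 : ∀ᶠ i in Filter.hyperfilter ℕ, δ'.map (ev i) ≠ 0 := by
    rw [Ne, map_toUltrapower_eq_zero_iff, ← Ultrafilter.eventually_not] at hδ
    exact hδ
  have h3 : ∀ᶠ i in Filter.hyperfilter ℕ, ∀ r ∈ hrs.toFinset,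
      Irreducible ((L r).map (mapRingHom (ev i))) := by
    refine (Filter.eventually_all_finset _).2 fun r hr' => ?_
    obtain ⟨hm, hi, -⟩ := hr r (hrs.mem_toFinset.1 hr')
    exact eventually_irreducible_map (hL r hm).1 (by rwa [(hL r hm).2.2])
  have hpt : ∀ i, ∃ x y : K,
      (Irreducible ((f'.map (mapRingHom (ev i))).map (mapRingHom (algebraMap K Ω))) →
      δ'.map (ev i) ≠ 0 →
      (∀ r ∈ hrs.toFinset, Irreducible ((L r).map (mapRingHom (ev i)))) →
      biEval (RingHom.id K) x y (f'.map (mapRingHom (ev i))) = 0 ∧ (δ'.map (ev i)).eval x ≠ 0 ∧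
      ¬ IsIntegral ℤ x ∧ ∀ r ∈ rs, ∀ z,
        biEval (RingHom.id K) x z ((L r).map (mapRingHom (ev i))) ≠ 0) := by
    intro i
    by_cases h : Irreducible ((f'.map (mapRingHom (ev i))).map (mapRingHom (algebraMap K Ω))) ∧
      δ'.map (ev i) ≠ 0 ∧ (∀ r ∈ hrs.toFinset, Irreducible ((L r).map (mapRingHom (ev i))))
    · obtain ⟨h4, h5, h6⟩ := h
      obtain ⟨x, y, h7, h8, h9, h10⟩ := hK (f'.map (mapRingHom (ev i)))
        (hrs.toFinset.toList.map fun r => (L r).map (mapRingHom (ev i))) (δ'.map (ev i))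
        (hf'.map _) h4 h5 (by
          intro q hq
          obtain ⟨r, hr', rfl⟩ := List.mem_map.1 hq
          have hr' := Finset.mem_toList.1 hr'
          obtain ⟨hm, hi, hd⟩ := hr r (hrs.mem_toFinset.1 hr')
          obtain ⟨hm', hd', -⟩ := hL r hm
          refine ⟨hm'.map _, h6 r hr', ?_⟩
          rwa [hf'.natDegree_map, hm'.natDegree_map, hd', hfd])
      refine ⟨x, y, fun _ _ _ => ⟨h7, h8, h9, fun r hr' z => h10 _ ?_ z⟩⟩
      exact List.mem_map.2 ⟨r, Finset.mem_toList.2 (hrs.mem_toFinset.2 hr'), rfl⟩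
    · exact ⟨0, 0, fun h4 h5 h6 => (h ⟨h4, h5, h6⟩).elim⟩
  choose x y hxy using hpt
  have hgood : ∀ᶠ i in Filter.hyperfilter ℕ,
      biEval (RingHom.id K) (x i) (y i) (f'.map (mapRingHom (ev i))) = 0 ∧
      (δ'.map (ev i)).eval (x i) ≠ 0 ∧ ¬ IsIntegral ℤ (x i) ∧ ∀ r ∈ rs, ∀ z,
        biEval (RingHom.id K) (x i) z ((L r).map (mapRingHom (ev i))) ≠ 0 := by
    filter_upwards [h1, h2, h3] with i g1 g2 g3 using hxy i g1 g2 g3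
  refine ⟨x, toUltrapower K y, ?_, ?_, hgood.mono fun i hi => hi.2.2.1, ?_⟩
  · exact (biEval_toUltrapower _ _ _).2 (hgood.mono fun i hi => hi.1)
  · intro h
    have h4 : biEval (RingHom.id _) (toUltrapower K x) (toUltrapower K y)
        ((C δ').map (mapRingHom (toUltrapower K))) = 0 := by
      rw [map_C, biEval_C, ← eval_map, Polynomial.map_id]
      exact h
    obtain ⟨i, hi, hi'⟩ := (((biEval_toUltrapower _ _ _).1 h4).and hgood).exists
    rw [map_C, biEval_C, ← eval_map, Polynomial.map_id] at hi
    exact hi'.2.1 hi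
  · intro r hr' z h
    obtain ⟨w, rfl⟩ := toUltrapower_surjective K z
    obtain ⟨-, -, hq⟩ := hL r (hr r hr').1
    rw [← hq] at h
    obtain ⟨i, hi, hi'⟩ := (((biEval_toUltrapower _ _ _).1 h).and hgood).exists
    exact hi'.2.2.2 r hr' _ hi

theorem ThinlyHilbertian.exists_partial_ringHom {K Ω A : Type*} [Field K] [CharZero K] [Field Ω]
    [Algebra K Ω] (hK : ThinlyHilbertian K Ω) [Field A] [CharZero A] {α β : A →+* Ultrapower K}
    (hα : RelAlgClosed α) (hβ : RelAlgClosed β) {b : Ultrapower K}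
    (hb : ∀ p : A[X], p.eval₂ α b = 0 → p = 0) {S : Set (Ultrapower K)} (hS : S.Finite)
    (halg : ∀ s ∈ S, ∃ p : A[X][X], p ≠ 0 ∧ biEval α b s p = 0)
    {H : Set (Ultrapower K)[X]} (hH : H.Finite)
    (hH' : ∀ h ∈ H, h.Monic ∧ Irreducible h ∧ 2 ≤ h.natDegree ∧ ∀ k, h.coeff k ∈ S) :
    ∃ (Λ : Subring (Ultrapower K)) (ψ : Λ →+* Ultrapower K) (x : ℕ → K), S ⊆ Λ ∧
      (∀ a, ∃ h : α a ∈ Λ, ψ ⟨α a, h⟩ = β a) ∧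
      (∃ h : b ∈ Λ, ψ ⟨b, h⟩ = toUltrapower K x) ∧
      (∀ᶠ i in Filter.hyperfilter ℕ, ¬ IsIntegral ℤ (x i)) ∧
      ∀ h : Λ[X], h.map Λ.subtype ∈ H → ∀ z, h.eval₂ ψ z ≠ 0 := by
  have : CharZero (Ultrapower K) := charZero_of_injective_ringHom α.injective
  let : Algebra A[X] (Ultrapower K) := (eval₂RingHom α b).toAlgebra
  have halgMap : ∀ p : A[X], algebraMap A[X] (Ultrapower K) p = p.eval₂ α b := fun _ => rfl
  have haeval : ∀ (c : Ultrapower K) (P : A[X][X]), aeval c P = biEval α b c P := fun _ _ => rfl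
  have : FaithfulSMul A[X] (Ultrapower K) := by
    rw [faithfulSMul_iff_algebraMap_injective, injective_iff_map_eq_zero]
    exact fun p hp => hb p hp
  obtain ⟨N, f, c, hSN, hf, hfc, hfd, hfrac, hdiv⟩ := exists_integral_primitive_element
    (R := A[X]) hS (fun s hs => halg s hs)
  have hdata : ∀ h : (Ultrapower K)[X], ∃ (r : A[X][X]) (G g : (Ultrapower K)[X]), h ∈ H →
      r.Monic ∧ Irreducible r ∧ f.natDegree < r.natDegree ∧ (∀ k, G.coeff k ∈ N) ∧
      (∀ k, g.coeff k ∈ N) ∧ eval₂ (C.comp (algebraMap A[X] (Ultrapower K))) G r = h * g := by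
    intro h
    by_cases hh : h ∈ H
    · obtain ⟨h1, h2, h3, h4⟩ := hH' h hh
      obtain ⟨r, h5, h6, h7, G, g, h8⟩ := hdiv h h1 h2 h3 (fun k => hSN (h4 k))
      exact ⟨r, G, g, fun _ => ⟨h5, h6, h7, h8⟩⟩
    · exact ⟨0, 0, 0, fun h' => (hh h').elim⟩
  choose r G g hrGg using hdata
  let T : Set (Ultrapower K) := S ∪ ⋃ h ∈ H, ((G h).coeffs ∪ (g h).coeffs : Set (Ultrapower K))
  have hT : T.Finite := hS.union (hH.biUnion fun h _ =>
    ((G h).coeffs.finite_toSet.union (g h).coeffs.finite_toSet))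
  have hTN : T ⊆ N := by
    rintro s (hs | hs)
    · exact hSN hs
    · simp only [Set.mem_iUnion] at hs
      obtain ⟨h, hh, hs | hs⟩ := hs
      · obtain ⟨n, -, rfl⟩ := mem_coeffs_iff.1 hs
        exact (hrGg h hh).2.2.2.1 n
      · obtain ⟨n, -, rfl⟩ := mem_coeffs_iff.1 hs
        exact (hrGg h hh).2.2.2.2.1 n
  obtain ⟨D, hD, hDT⟩ := exists_common_denominator hfrac hT hTN
  have hfi := irreducible_map_of_relAlgClosed hα hf hfc
    (fun q hq hlt => eq_zero_of_dvd_of_natDegree_lt (hfd q hq) hlt)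
    ((Ultrapower.map (algebraMap K Ω)).comp β)
  rw [← mapRingHom_comp, ← Polynomial.map_map] at hfi
  obtain ⟨x, y, hxy, hδ, hx, hroots⟩ := hK.exists_generic_point (hf.map (mapRingHom β)) hfi
    (δ := D.map β) (by rwa [Ne, Polynomial.map_eq_zero])
    (rs := (fun h => (r h).map (mapRingHom β)) '' H) (hH.image _) (by
      rintro _ ⟨h, hh, rfl⟩
      obtain ⟨h1, h2, h3, -⟩ := hrGg h hh
      refine ⟨h1.map _, hβ.irreducible_map_map h1 h2, ?_⟩
      rwa [hf.natDegree_map, h1.natDegree_map])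
  rw [biEval_map, RingHom.id_comp] at hxy
  rw [eval_map] at hδ
  obtain ⟨Λ, ψ, hψ, hΛ⟩ := exists_ringHom_of_ker_le (biEval α b c) (biEval β (toUltrapower K x) y)
    (fun p hp => by
      obtain ⟨q, rfl⟩ := hfd p hp
      rw [map_mul, hxy, zero_mul])
    (D := C D) (by rw [biEval_C]; exact fun h => hD (hb D h)) (by rwa [biEval_C])
  have hTΛ : T ⊆ Λ := by
    intro s hs
    obtain ⟨P, hP⟩ := hDT s hs
    exact hΛ s P (by rw [biEval_C]; exact hP)
  have hC : ∀ p : A[X], ∃ h : p.eval₂ α b ∈ Λ, ψ ⟨p.eval₂ α b, h⟩ = p.eval₂ β (toUltrapower K x) := by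
    intro p
    obtain ⟨h, hp⟩ := hψ (C p)
    simp only [biEval_C] at h hp
    exact ⟨h, hp⟩
  refine ⟨Λ, ψ, x, Set.subset_union_left.trans hTΛ, fun a => ?_, ?_, hx, ?_⟩
  · simpa only [eval₂_C] using hC (C a)
  · simpa only [eval₂_X] using hC X
  · intro h hh z hz
    obtain ⟨-, -, -, -, -, hG⟩ := hrGg _ hh
    have hlift : ∀ q : (Ultrapower K)[X], (q.coeffs : Set (Ultrapower K)) ⊆ T →
        ∃ q' : Λ[X], q'.map Λ.subtype = q := by
      intro q hq
      refine (mem_lifts q).1 ((lifts_iff_coeff_lifts q).2 fun n => ?_)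
      by_cases hn : q.coeff n = 0
      · exact ⟨0, by rw [hn, map_zero]⟩
      · exact ⟨⟨q.coeff n, hTΛ (hq (coeff_mem_coeffs hn))⟩, rfl⟩
    have hsub : ((G (h.map Λ.subtype)).coeffs ∪ (g (h.map Λ.subtype)).coeffs :
        Set (Ultrapower K)) ⊆ T :=
      (Set.subset_biUnion_of_mem (u := fun h => ((G h).coeffs ∪ (g h).coeffs :
        Set (Ultrapower K))) hh).trans Set.subset_union_right
    obtain ⟨G', hG'⟩ := hlift _ (Set.subset_union_left.trans hsub)
    obtain ⟨g', hg'⟩ := hlift _ (Set.subset_union_right.trans hsub)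
    let ι : A[X] →+* Λ := (eval₂RingHom α b).codRestrict Λ fun p => (hC p).1
    have hι : Λ.subtype.comp ι = eval₂RingHom α b := rfl
    have hψι : ψ.comp ι = eval₂RingHom β (toUltrapower K x) := by
      ext p
      · exact (hC (C p)).2.trans (by simp)
      · exact (hC X).2.trans (by simp)
    have key : eval₂ (C.comp ι) G' (r (h.map Λ.subtype)) = h * g' := by
      apply map_injective Λ.subtype Subtype.val_injective
      rw [Polynomial.map_mul, hg', ← hG, ← hG', ← coe_mapRingHom, hom_eval₂]
      congr 1
      ext p <;> simp [ι] <;> rfl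
    have key2 := congrArg (eval₂RingHom ψ z) key
    rw [hom_eval₂, map_mul, coe_eval₂RingHom, hz, zero_mul] at key2
    refine hroots _ ⟨_, hh, rfl⟩ (eval₂ ψ z G') ?_
    rw [biEval_map, RingHom.id_comp, ← key2, biEval_apply]
    congr 1
    rw [← hψι]
    ext p <;> simp

theorem exists_countable_relAlgClosed_subfield {R M : Type} [CommRing R] [IsDomain R] [Countable R]
    [Field M] [Algebra R M] [FaithfulSMul R M] :
    ∃ B : Subfield M, Countable B ∧ RelAlgClosed B.subtype ∧ (∀ r, algebraMap R M r ∈ B) ∧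
      ∀ s ∈ B, IsAlgebraic R s := by
  let k := FractionRing R
  let : Algebra k M := FractionRing.liftAlgebra R M
  have : IsScalarTower R k M := FractionRing.isScalarTower_liftAlgebra R M
  refine ⟨(algebraicClosure k M).toSubfield, ?_, ?_, fun r => ?_, fun s hs => ?_⟩
  · have h := Algebra.IsAlgebraic.cardinalMk_le_max k (algebraicClosure k M)
    have hk : Cardinal.mk k ≤ Cardinal.aleph0 := by
      have : Countable k := (IsLocalization.mk'_surjective (nonZeroDivisors R)).countable
      exact Cardinal.mk_le_aleph0_iff.2 this
    exact Cardinal.mk_le_aleph0_iff.1 (h.trans (max_le hk le_rfl))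
  · intro z p hp hz
    have h1 : IsAlgebraic (algebraicClosure k M) z := ⟨p, hp, hz⟩
    exact ⟨⟨z, (mem_algebraicClosure_iff).2 (h1.restrictScalars k)⟩, rfl⟩
  · rw [IsScalarTower.algebraMap_apply R k M]
    exact (algebraicClosure k M).algebraMap_mem _
  · exact (IsFractionRing.isAlgebraic_iff R k M).2 (mem_algebraicClosure_iff.1 hs)

/-- A choice of a sequence representing an element of an ultrapower. -/
noncomputable def Ultrapower.rep {κ : Type*} [Field κ] : Ultrapower κ → ℕ → κ :=
  Function.surjInv (toUltrapower_surjective κ)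

theorem Ultrapower.toUltrapower_rep {κ : Type*} [Field κ] (z : Ultrapower κ) :
    toUltrapower κ z.rep = z :=
  Function.surjInv_eq _ z

theorem eventually_forall_sum_ne_zero {κ : Type*} [Field κ] {R : Type*} [CommRing R] [Nontrivial R]
    (ψ : R →+* Ultrapower κ) (w : R → ℕ → κ) (hw : ∀ s, toUltrapower κ (w s) = ψ s) (h : R[X])
    (hh : ∀ z, h.eval₂ ψ z ≠ 0) :
    ∀ᶠ i in Filter.hyperfilter ℕ, ∀ z : κ,
      ∑ k ∈ Finset.range (h.natDegree + 1), w (h.coeff k) i * z ^ k ≠ 0 := by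
  by_contra hcon
  rw [← Ultrafilter.eventually_not] at hcon
  push Not at hcon
  have hz : ∀ i, ∃ z : κ, (∃ z : κ,
      ∑ k ∈ Finset.range (h.natDegree + 1), w (h.coeff k) i * z ^ k = 0) →
      ∑ k ∈ Finset.range (h.natDegree + 1), w (h.coeff k) i * z ^ k = 0 := by
    intro i
    by_cases hi : ∃ z : κ, ∑ k ∈ Finset.range (h.natDegree + 1), w (h.coeff k) i * z ^ k = 0
    · exact ⟨hi.choose, fun _ => hi.choose_spec⟩
    · exact ⟨0, fun h => (hi h).elim⟩
  choose z hz using hz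
  refine hh (toUltrapower κ z) ?_
  rw [eval₂_eq_sum_range]
  simp_rw [← hw, ← map_pow, ← map_mul, ← map_sum]
  rw [toUltrapower_eq_zero_iff]
  filter_upwards [hcon] with i hi
  simpa using hz i hi

theorem ThinlyHilbertian.exists_extension {K Ω A : Type} [Field K] [CharZero K] [Field Ω]
    [Algebra K Ω] (hK : ThinlyHilbertian K Ω) [Field A] [CharZero A] [Countable A]
    {α β : A →+* Ultrapower K} (hα : RelAlgClosed α) (hβ : RelAlgClosed β) {b : Ultrapower K}
    (hb : b ∉ Set.range α) :
    ∃ (B : Subfield (Ultrapower K)) (β' : B →+* Ultrapower K), Countable B ∧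
      RelAlgClosed B.subtype ∧ RelAlgClosed β' ∧ (∀ a, ∃ h : α a ∈ B, β' ⟨α a, h⟩ = β a) ∧
      ∃ (h : b ∈ B) (x : ℕ → K), β' ⟨b, h⟩ = toUltrapower K x ∧
        ∀ᶠ i in Filter.hyperfilter ℕ, ¬ IsIntegral ℤ (x i) := by
  classical
  have hb' : ∀ p : A[X], p.eval₂ α b = 0 → p = 0 := fun p hp => by
    by_contra h
    exact hb (hα b p h hp)
  let : Algebra A[X] (Ultrapower K) := (eval₂RingHom α b).toAlgebra
  have : FaithfulSMul A[X] (Ultrapower K) := by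
    rw [faithfulSMul_iff_algebraMap_injective, injective_iff_map_eq_zero]
    exact fun p hp => hb' p hp
  have : Countable A[X] := countable_polynomial A
  obtain ⟨B, hBc, hB, hRB, halg⟩ := exists_countable_relAlgClosed_subfield
    (R := A[X]) (M := Ultrapower K)
  have : Countable B[X] := countable_polynomial B
  have hαB : ∀ a, α a ∈ B := fun a => by simpa using! (show eval₂ α b (C a) ∈ B from hRB (C a))
  have hbB : b ∈ B := by simpa using! (show eval₂ α b X ∈ B from hRB X)
  let P : B × B × A × B[X] → ℕ → (B → K) → Prop := fun c i v =>
    v (c.1 + c.2.1) = v c.1 + v c.2.1 ∧ v (c.1 * c.2.1) = v c.1 * v c.2.1 ∧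
    v ⟨α c.2.2.1, hαB _⟩ = (β c.2.2.1).rep i ∧ ¬ IsIntegral ℤ (v ⟨b, hbB⟩) ∧
    (c.2.2.2.Monic ∧ Irreducible c.2.2.2 ∧ 2 ≤ c.2.2.2.natDegree → ∀ z : K,
      ∑ k ∈ Finset.range (c.2.2.2.natDegree + 1), v (c.2.2.2.coeff k) * z ^ k ≠ 0)
  have hP : ∀ s : Finset (B × B × A × B[X]), ∀ᶠ i in Filter.hyperfilter ℕ, ∃ v, ∀ c ∈ s,
      P c i v := by
    intro s
    obtain ⟨E, hE⟩ : ∃ E : B × B × A × B[X] → Finset B, ∀ c, c.1 ∈ E c ∧ c.2.1 ∈ E c ∧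
        c.1 + c.2.1 ∈ E c ∧ c.1 * c.2.1 ∈ E c ∧ c.2.2.2.coeffs ⊆ E c :=
      ⟨fun c => {c.1, c.2.1, c.1 + c.2.1, c.1 * c.2.1} ∪ c.2.2.2.coeffs, fun c =>
        ⟨by simp, by simp, by simp, by simp, Finset.subset_union_right⟩⟩
    let S₀ : Finset B := insert 0 (s.biUnion E)
    have hS₀ : ∀ c ∈ s, E c ⊆ S₀ := fun c hc u hu =>
      Finset.mem_insert_of_mem (Finset.mem_biUnion.2 ⟨c, hc, hu⟩)
    obtain ⟨Λ, ψ, x, hSΛ, hψα, ⟨hbΛ, hψb⟩, hx, hroots⟩ := hK.exists_partial_ringHom hα hβ hb'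
      (S := B.subtype '' S₀) (S₀.finite_toSet.image _)
      (by rintro _ ⟨u, -, rfl⟩; exact halg u u.2)
      (H := (fun c : B × B × A × B[X] => c.2.2.2.map B.subtype) ''
        {c | c ∈ s ∧ c.2.2.2.Monic ∧ Irreducible c.2.2.2 ∧ 2 ≤ c.2.2.2.natDegree})
      ((s.finite_toSet.subset fun c hc => hc.1).image _) (by
        rintro _ ⟨c, ⟨hc, h1, h2, h3⟩, rfl⟩
        refine ⟨h1.map _, hB.irreducible_map h1 h2, by rwa [h1.natDegree_map], fun k => ?_⟩
        refine ⟨c.2.2.2.coeff k, ?_, by rw [coeff_map]⟩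
        by_cases hk : c.2.2.2.coeff k = 0
        · rw [hk]; exact Finset.mem_insert_self _ _
        · exact hS₀ c hc ((hE c).2.2.2.2 (coeff_mem_coeffs hk)))
    have hSΛ' : ∀ u ∈ S₀, (u : Ultrapower K) ∈ Λ := fun u hu => hSΛ ⟨u, hu, rfl⟩
    let w : Λ → ℕ → K := fun u => (ψ u).rep
    have hw : ∀ u, toUltrapower K (w u) = ψ u := fun u => Ultrapower.toUltrapower_rep _
    let v : ℕ → B → K := fun i u => if h : (u : Ultrapower K) ∈ Λ then w ⟨u, h⟩ i else 0
    have hv : ∀ (u : B) (h : (u : Ultrapower K) ∈ Λ) i, v i u = w ⟨u, h⟩ i := fun u h i => dif_pos h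
    suffices h : ∀ c ∈ s, ∀ᶠ i in Filter.hyperfilter ℕ, P c i (v i) from
      ((Filter.eventually_all_finset s).2 h).mono fun i hi => ⟨v i, hi⟩
    intro c hc
    have hsub := hS₀ c hc
    have m1 : (c.1 : Ultrapower K) ∈ Λ := hSΛ' _ (hsub (hE c).1)
    have m2 : (c.2.1 : Ultrapower K) ∈ Λ := hSΛ' _ (hsub (hE c).2.1)
    have m3 : ((c.1 + c.2.1 : B) : Ultrapower K) ∈ Λ := hSΛ' _ (hsub (hE c).2.2.1)
    have m4 : ((c.1 * c.2.1 : B) : Ultrapower K) ∈ Λ := hSΛ' _ (hsub (hE c).2.2.2.1)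
    obtain ⟨m5, h5⟩ := hψα c.2.2.1
    have e1 : ∀ᶠ i in Filter.hyperfilter ℕ, w ⟨_, m3⟩ i = w ⟨_, m1⟩ i + w ⟨_, m2⟩ i := by
      have h : toUltrapower K (w ⟨_, m3⟩) = toUltrapower K (w ⟨_, m1⟩ + w ⟨_, m2⟩) := by
        rw [map_add, hw, hw, hw, ← map_add]
        rfl
      exact toUltrapower_eq_iff.1 h
    have e2 : ∀ᶠ i in Filter.hyperfilter ℕ, w ⟨_, m4⟩ i = w ⟨_, m1⟩ i * w ⟨_, m2⟩ i := by
      have h : toUltrapower K (w ⟨_, m4⟩) = toUltrapower K (w ⟨_, m1⟩ * w ⟨_, m2⟩) := by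
        rw [map_mul, hw, hw, hw, ← map_mul]
        rfl
      exact toUltrapower_eq_iff.1 h
    have e3 : ∀ᶠ i in Filter.hyperfilter ℕ, w ⟨_, hbΛ⟩ i = x i :=
      toUltrapower_eq_iff.1 ((hw _).trans hψb)
    have e4 : ∀ᶠ i in Filter.hyperfilter ℕ, c.2.2.2.Monic ∧ Irreducible c.2.2.2 ∧
        2 ≤ c.2.2.2.natDegree → ∀ z : K, ∑ k ∈ Finset.range (c.2.2.2.natDegree + 1),
          v i (c.2.2.2.coeff k) * z ^ k ≠ 0 := by
      by_cases hirr : c.2.2.2.Monic ∧ Irreducible c.2.2.2 ∧ 2 ≤ c.2.2.2.natDegree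
      swap
      · exact Filter.Eventually.of_forall fun i h => (hirr h).elim
      have mk : ∀ k, (c.2.2.2.coeff k : Ultrapower K) ∈ Λ := by
        intro k
        by_cases hk : c.2.2.2.coeff k = 0
        · rw [hk]; exact Λ.zero_mem
        · exact hSΛ' _ (hsub (hE c |>.2.2.2.2 (coeff_mem_coeffs hk)))
      obtain ⟨h', hh'⟩ := (mem_lifts _).1 ((lifts_iff_coeff_lifts (f := Λ.subtype)
        (c.2.2.2.map B.subtype)).2 fun k => ⟨⟨_, mk k⟩, by rw [coeff_map]; rfl⟩)
      have hdeg : h'.natDegree = c.2.2.2.natDegree := by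
        rw [← natDegree_map_eq_of_injective (f := Λ.subtype) Subtype.val_injective, hh',
          natDegree_map]
      have hcoeff : ∀ k, h'.coeff k = ⟨_, mk k⟩ := by
        intro k
        have := congrArg (coeff · k) hh'
        simp only [coeff_map] at this
        exact Subtype.ext this
      filter_upwards [eventually_forall_sum_ne_zero ψ w hw h'
        (hroots h' ⟨c, ⟨hc, hirr⟩, hh'.symm⟩)] with i hi _ z hz
      refine hi z ?_
      rw [hdeg, ← hz]
      refine Finset.sum_congr rfl fun k _ => ?_
      rw [hcoeff, hv _ (mk k)]
    filter_upwards [e1, e2, e3, e4, hx] with i g1 g2 g3 g4 g5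
    refine ⟨?_, ?_, ?_, ?_, g4⟩
    · rw [hv _ m1, hv _ m2, hv _ m3, g1]
    · rw [hv _ m1, hv _ m2, hv _ m4, g2]
    · rw [hv _ m5, ← h5]
    · rwa [hv _ hbΛ, g3]
  obtain ⟨v, hv⟩ := exists_forall_eventually_of_finite
    (Filter.hyperfilter_le_cofinite.trans Nat.cofinite_eq_atTop.le) P hP
  let w : B → ℕ → K := fun u i => v i u
  have hα' : ∀ a, toUltrapower K (w ⟨α a, hαB a⟩) = β a := fun a => by
    rw [← Ultrapower.toUltrapower_rep (β a), toUltrapower_eq_iff]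
    exact (hv (0, 0, a, 0)).mono fun i hi => hi.2.2.1
  let β' : B →+* Ultrapower K := RingHom.mk'
    { toFun := fun u => toUltrapower K (w u)
      map_one' := by
        rw [← map_one β, ← hα' 1]
        congr 2
        exact Subtype.ext (map_one α).symm
      map_mul' := fun s t => by
        rw [← map_mul, toUltrapower_eq_iff]
        exact (hv (s, t, 0, 0)).mono fun i hi => hi.2.1 }
    fun s t => by
      change toUltrapower K _ = toUltrapower K _ + toUltrapower K _
      rw [← map_add, toUltrapower_eq_iff]
      exact (hv (s, t, 0, 0)).mono fun i hi => hi.1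
  refine ⟨B, β', hBc, hB, ?_, fun a => ⟨hαB a, hα' a⟩, hbB, w ⟨b, hbB⟩, rfl, ?_⟩
  · intro z p hp hz
    let : Algebra B (Ultrapower K) := β'.toAlgebra
    have hint : IsIntegral B z := isAlgebraic_iff_isIntegral.1 ⟨p, hp, hz⟩
    have hdeg : (minpoly B z).natDegree = 1 := by
      by_contra hne
      have h2 : 2 ≤ (minpoly B z).natDegree := by
        have := minpoly.natDegree_pos hint
        omega
      obtain ⟨u, rfl⟩ := toUltrapower_surjective K z
      have h0 : eval₂ β' (toUltrapower K u) (minpoly B (toUltrapower K u)) = 0 :=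
        minpoly.aeval B (toUltrapower K u)
      rw [eval₂_eq_sum_range] at h0
      have h1 : toUltrapower K (∑ k ∈ Finset.range ((minpoly B (toUltrapower K u)).natDegree + 1),
          w ((minpoly B (toUltrapower K u)).coeff k) * u ^ k) = 0 := by
        rw [← h0, map_sum]
        exact Finset.sum_congr rfl fun k _ => by rw [map_mul, map_pow]; rfl
      obtain ⟨i, hi, hi'⟩ := ((toUltrapower_eq_zero_iff.1 h1).and
        (hv (0, 0, 0, minpoly B (toUltrapower K u)))).exists
      refine hi'.2.2.2.2 ⟨minpoly.monic hint, minpoly.irreducible hint, h2⟩ (u i) ?_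
      simpa using! hi
    exact minpoly.natDegree_eq_one_iff.1 hdeg
  · exact (hv (0, 0, 0, 0)).mono fun i hi => hi.2.2.2.1

theorem ThinlyHilbertian.exists_match {K Ω A : Type} [Field K] [CharZero K] [Field Ω]
    [Algebra K Ω] (hK : ThinlyHilbertian K Ω) [Field A] [Countable A]
    {α β : A →+* Ultrapower K} (hα : RelAlgClosed α) (hβ : RelAlgClosed β) (y : ℕ → K) :
    ∃ (B : Type) (_ : Field B) (α' β' : B →+* Ultrapower K) (y' : ℕ → K), Countable B ∧
      RelAlgClosed α' ∧ RelAlgClosed β' ∧ (∀ a, ∃ e, α' e = α a ∧ β' e = β a) ∧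
      ∃ e, α' e = toUltrapower K y ∧ β' e = toUltrapower K y' := by
  by_cases hb : toUltrapower K y ∈ Set.range α
  · obtain ⟨e, he⟩ := hb
    exact ⟨A, _, α, β, (β e).rep, ‹_›, hα, hβ, fun a => ⟨a, rfl, rfl⟩, e, he,
      (Ultrapower.toUltrapower_rep _).symm⟩
  · have : CharZero (Ultrapower K) := charZero_of_injective_ringHom
      ((toUltrapower K).comp (Pi.constRingHom ℕ K)).injective
    have : CharZero A := (α.charZero_iff α.injective).2 this
    obtain ⟨B, β', hBc, hB, hβ', hext, h, x, hx, -⟩ := hK.exists_extension hα hβ hb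
    refine ⟨B, _, B.subtype, β', x, hBc, hB, hβ', fun a => ?_, ⟨_, h⟩, rfl, hx⟩
    obtain ⟨h, ha⟩ := hext a
    exact ⟨⟨_, h⟩, rfl, ha⟩

section Realize

open FirstOrder FirstOrder.Language

theorem exists_toUltrapower_realize_term {K A : Type*} [Field K] [Ring.CompatibleRing K] [Field A]
    {α β : A →+* Ultrapower K} {V : Type*} {a a' : V → ℕ → K}
    (h : ∀ j, ∃ e, α e = toUltrapower K (a j) ∧ β e = toUltrapower K (a' j))
    (t : Language.ring.Term V) :
    ∃ e, α e = toUltrapower K (fun i => t.realize fun j => a j i) ∧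
      β e = toUltrapower K (fun i => t.realize fun j => a' j i) := by
  induction t with
  | var j => exact h j
  | func f ts ih =>
    choose e he using ih
    cases f with
    | add =>
      refine ⟨e 0 + e 1, ?_, ?_⟩ <;> rw [map_add]
      · rw [(he 0).1, (he 1).1, ← map_add]
        exact congrArg _ (funext fun i => (Ring.CompatibleRing.funMap_add
          fun j => (ts j).realize fun k => a k i).symm)
      · rw [(he 0).2, (he 1).2, ← map_add]
        exact congrArg _ (funext fun i => (Ring.CompatibleRing.funMap_add
          fun j => (ts j).realize fun k => a' k i).symm)
    | mul =>
      refine ⟨e 0 * e 1, ?_, ?_⟩ <;> rw [map_mul]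
      · rw [(he 0).1, (he 1).1, ← map_mul]
        exact congrArg _ (funext fun i => (Ring.CompatibleRing.funMap_mul
          fun j => (ts j).realize fun k => a k i).symm)
      · rw [(he 0).2, (he 1).2, ← map_mul]
        exact congrArg _ (funext fun i => (Ring.CompatibleRing.funMap_mul
          fun j => (ts j).realize fun k => a' k i).symm)
    | neg =>
      refine ⟨-e 0, ?_, ?_⟩ <;> rw [map_neg]
      · rw [(he 0).1, ← map_neg]
        exact congrArg _ (funext fun i => (Ring.CompatibleRing.funMap_neg
          fun j => (ts j).realize fun k => a k i).symm)
      · rw [(he 0).2, ← map_neg]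
        exact congrArg _ (funext fun i => (Ring.CompatibleRing.funMap_neg
          fun j => (ts j).realize fun k => a' k i).symm)
    | zero =>
      refine ⟨0, ?_, ?_⟩ <;> rw [map_zero, ← map_zero (toUltrapower K)] <;>
        exact congrArg _ (funext fun i => (Ring.CompatibleRing.funMap_zero _).symm)
    | one =>
      refine ⟨1, ?_, ?_⟩ <;> rw [map_one, ← map_one (toUltrapower K)] <;>
        exact congrArg _ (funext fun i => (Ring.CompatibleRing.funMap_one _).symm)

theorem Ultrafilter.eventually_iff_of_iff {ι : Type*} {U : Ultrafilter ι} {p q : ι → Prop}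
    (h : (∀ᶠ i in U, p i) ↔ ∀ᶠ i in U, q i) : ∀ᶠ i in U, (p i ↔ q i) := by
  by_cases hp : ∀ᶠ i in U, p i
  · filter_upwards [hp, h.1 hp] with i h1 h2 using iff_of_true h1 h2
  · filter_upwards [Ultrafilter.eventually_not.2 hp, Ultrafilter.eventually_not.2 (h.not.1 hp)]
      with i h1 h2 using iff_of_false h1 h2

theorem ThinlyHilbertian.eventually_realize_iff {K Ω : Type} [Field K] [CharZero K] [Field Ω]
    [Algebra K Ω] (hK : ThinlyHilbertian K Ω) [Ring.CompatibleRing K] {V : Type*} {n : ℕ}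
    (φ : Language.ring.BoundedFormula V n) :
    ∀ {A : Type} [Field A] [Countable A] {α β : A →+* Ultrapower K}, RelAlgClosed α →
      RelAlgClosed β → ∀ {a a' : V → ℕ → K} {x x' : Fin n → ℕ → K},
      (∀ j, ∃ e, α e = toUltrapower K (a j) ∧ β e = toUltrapower K (a' j)) →
      (∀ j, ∃ e, α e = toUltrapower K (x j) ∧ β e = toUltrapower K (x' j)) →
      ∀ᶠ i in Filter.hyperfilter ℕ, (φ.Realize (fun j => a j i) (fun j => x j i) ↔
        φ.Realize (fun j => a' j i) (fun j => x' j i)) := by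
  induction φ with
  | falsum => exact fun _ _ _ _ _ _ _ _ => .of_forall fun i => Iff.rfl
  | @equal m t₁ t₂ =>
    intro A _ _ α β hα hβ a a' x x' ha hx
    have hax : ∀ j, ∃ e, α e = toUltrapower K (Sum.elim a x j) ∧
        β e = toUltrapower K (Sum.elim a' x' j) := by
      rintro (j | j)
      exacts [ha j, hx j]
    obtain ⟨e₁, h₁, h₁'⟩ := exists_toUltrapower_realize_term hax t₁
    obtain ⟨e₂, h₂, h₂'⟩ := exists_toUltrapower_realize_term hax t₂
    have hsum : ∀ (b : V → ℕ → K) (y : Fin m → ℕ → K) i, (fun j => Sum.elim b y j i) =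
        Sum.elim (fun j => b j i) (fun j => y j i) := fun b y i => by
      ext (j | j) <;> rfl
    simp only [hsum] at h₁ h₁' h₂ h₂'
    refine Ultrafilter.eventually_iff_of_iff ?_
    have h3 := toUltrapower_eq_iff.symm.trans (h₁ ▸ h₂ ▸ α.injective.eq_iff (a := e₁) (b := e₂))
    have h4 := toUltrapower_eq_iff.symm.trans (h₁' ▸ h₂' ▸ β.injective.eq_iff (a := e₁) (b := e₂))
    exact h3.trans h4.symm
  | rel R ts => exact (R : Empty).elim
  | imp f₁ f₂ ih₁ ih₂ =>
    intro A _ _ α β hα hβ a a' x x' ha hx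
    filter_upwards [ih₁ hα hβ ha hx, ih₂ hα hβ ha hx] with i h1 h2
    rw [BoundedFormula.realize_imp, BoundedFormula.realize_imp, h1, h2]
  | @all n f ih =>
    have key : ∀ {A : Type} [Field A] [Countable A] {α β : A →+* Ultrapower K}, RelAlgClosed α →
      RelAlgClosed β → ∀ {a a' : V → ℕ → K} {x x' : Fin n → ℕ → K},
      (∀ j, ∃ e, α e = toUltrapower K (a j) ∧ β e = toUltrapower K (a' j)) →
      (∀ j, ∃ e, α e = toUltrapower K (x j) ∧ β e = toUltrapower K (x' j)) →
      ∀ᶠ i in Filter.hyperfilter ℕ, (f.all.Realize (fun j => a' j i) (fun j => x' j i) →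
        f.all.Realize (fun j => a j i) (fun j => x j i)) := by
      intro A _ _ α β hα hβ a a' x x' ha hx
      have hy : ∀ i, ∃ y : K, f.Realize (fun j => a j i) (Fin.snoc (fun j => x j i) y) →
          f.all.Realize (fun j => a j i) (fun j => x j i) := by
        intro i
        by_cases h : f.all.Realize (fun j => a j i) (fun j => x j i)
        · exact ⟨0, fun _ => h⟩
        · rw [BoundedFormula.realize_all] at h
          push Not at h
          obtain ⟨y, hy⟩ := h
          exact ⟨y, fun h => (hy h).elim⟩
      choose y hy using hy
      obtain ⟨B, _, α', β', y', _, hα', hβ', hext, e, he, he'⟩ := hK.exists_match hα hβ y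
      have hlift : ∀ u u' : ℕ → K, (∃ e, α e = toUltrapower K u ∧ β e = toUltrapower K u') →
          ∃ e, α' e = toUltrapower K u ∧ β' e = toUltrapower K u' := by
        rintro u u' ⟨e, h1, h2⟩
        obtain ⟨e', h3, h4⟩ := hext e
        exact ⟨e', h3.trans h1, h4.trans h2⟩
      have hsnoc : ∀ (x : Fin n → ℕ → K) (y : ℕ → K) i,
          (fun j => (Fin.snoc x y : Fin (n + 1) → ℕ → K) j i) =
            (Fin.snoc (fun j => x j i) (y i) : Fin (n + 1) → K) := by
        intro x y i
        ext j
        refine Fin.lastCases ?_ (fun j => ?_) j <;> simp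
      have := ih hα' hβ' (x := Fin.snoc x y) (x' := Fin.snoc x' y')
        (fun j => hlift _ _ (ha j)) (fun j => by
          refine Fin.lastCases ?_ (fun j => ?_) j
          · simpa using ⟨e, he, he'⟩
          · simpa using hlift _ _ (hx j))
      filter_upwards [this] with i hi h
      rw [hsnoc, hsnoc] at hi
      exact hy i (hi.2 (h (y' i)))
    intro A _ _ α β hα hβ a a' x x' ha hx
    filter_upwards [key hα hβ ha hx, key hβ hα (fun j => (ha j).imp fun _ => And.symm)
      (fun j => (hx j).imp fun _ => And.symm)] with i h1 h2 using ⟨h2, h1⟩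

end Realize

theorem relAlgClosed_toUltrapower_const {K : Type*} [Field K] :
    RelAlgClosed ((toUltrapower K).comp (Pi.constRingHom ℕ K)) := by
  intro z p hp hz
  obtain ⟨u, rfl⟩ := toUltrapower_surjective K z
  rw [← hom_eval₂, toUltrapower_eq_zero_iff] at hz
  have h : ∀ᶠ i in Filter.hyperfilter ℕ, ∃ c ∈ p.rootSet K, u i = c := by
    filter_upwards [hz] with i hi
    refine ⟨u i, ?_, rfl⟩
    rw [mem_rootSet_of_ne hp, aeval_def]
    have := (hom_eval₂ p (Pi.constRingHom ℕ K) (Pi.evalRingHom (fun _ => K) i) u).symm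
    exact this.trans hi
  rw [Ultrafilter.eventually_exists_mem_iff (p.rootSet_finite K)] at h
  obtain ⟨c, -, hc⟩ := h
  exact ⟨c, (toUltrapower_eq_iff.2 hc).symm⟩

theorem ThinlyHilbertian.not_definableIn {K Ω : Type} [Field K] [CharZero K] [Countable K]
    [Field Ω] [Algebra K Ω] (hK : ThinlyHilbertian K Ω) {s : Set K} (hs : intSet K ⊆ s)
    (hs' : s ⊆ ringOfIntegers K) : ¬ DefinableIn K s := by
  intro h
  let := FirstOrder.Ring.compatibleRingOfRing K
  have h : Set.Definable₁ (Set.univ : Set K) FirstOrder.Language.ring s := h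
  obtain ⟨φ, hφ⟩ := Set.definable_iff_exists_formula_sum.1 h
  have hφ' : ∀ x : K, x ∈ s ↔ φ.Realize (Sum.elim (↑) fun _ : Fin 1 => x) := fun x =>
    Set.ext_iff.1 hφ fun _ => x
  let κ := (toUltrapower K).comp (Pi.constRingHom ℕ K)
  have hκ' : RelAlgClosed κ := relAlgClosed_toUltrapower_const
  have hb : toUltrapower K (fun i => (i : K)) ∉ Set.range κ := by
    rintro ⟨c, hc⟩
    have h1 : ∀ᶠ i : ℕ in Filter.hyperfilter ℕ, c = (i : K) := toUltrapower_eq_iff.1 hc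
    obtain ⟨i, hi⟩ := h1.exists
    obtain ⟨j, hj, hij⟩ := (h1.and ((Filter.hyperfilter_le_cofinite.trans Nat.cofinite_eq_atTop.le)
      (Filter.eventually_ne_atTop i))).exists
    exact hij (Nat.cast_injective (hj.symm.trans hi))
  obtain ⟨B, β, _, hB, hβ, hext, hbB, x, hx, hxi⟩ := hK.exists_extension hκ' hκ' hb
  have key := hK.eventually_realize_iff φ (V := (Set.univ : Set K) ⊕ Fin 1) hB hβ
    (a := Sum.elim (fun c _ => c) fun _ i => (i : K)) (a' := Sum.elim (fun c _ => c) fun _ => x)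
    (x := default) (x' := default) (by
      rintro (c | j)
      · obtain ⟨h, hc⟩ := hext c
        exact ⟨⟨_, h⟩, rfl, hc⟩
      · exact ⟨⟨_, hbB⟩, rfl, hx⟩) fun j => j.elim0
  obtain ⟨i, hi, hi'⟩ := (key.and hxi).exists
  refine hi' (hs' ((hφ' _).2 ?_))
  have h1 := (hφ' i).1 (hs ⟨i, Int.cast_natCast i⟩)
  have hv : ∀ u : ℕ → K, (fun j => (Sum.elim (fun c _ => c) fun _ => u :
      (Set.univ : Set K) ⊕ Fin 1 → ℕ → K) j i) = Sum.elim (↑) fun _ => u i := by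
    intro u
    ext (j | j) <;> rfl
  rw [hv, hv, Subsingleton.elim (fun j => (default : Fin 0 → ℕ → K) j i) default] at hi
  exact hi.1 h1

end Preliminaries

/-- The set of subfields `F` of `Q̄` in which `ℤ` or `𝒪_F` is definable
(by a first-order formula in the language of rings with parameters from `F`)
is meager in the space `𝓔` of all subfields of `Q̄`. -/
theorem meager_int_or_ringOfIntegers_definable :
    IsMeagre {F : Subfield Qbar |
      DefinableIn F (intSet F) ∨ DefinableIn F (ringOfIntegers F)} := by
  refine IsMeagre.mono ?_ isMeagre_not_thinlyHilbertian
  intro F hF hT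
  have := countable_qbar
  have : Countable F := Subtype.countable
  have h : intSet F ⊆ ringOfIntegers F := by
    rintro _ ⟨n, rfl⟩
    exact isIntegral_algebraMap (R := ℤ) (x := n)
  exact hF.elim (hT.not_definableIn subset_rfl h) (hT.not_definableIn h subset_rfl)
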